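/- arXiv:1210.6608 — 4 statements merged into one kernel-verified Lean document; each statement's English description precedes it below -/
import Mathlib

section
/- Let A be a C*-algebra, let à denote its minimal unitization, and let k ≥ 1. If Gen_k(Ã)_sa is dense in Ã^k_sa, then Lg_k(Ã)_sa is dense in Ã^k_sa. In other words, the real rank of A is at most the generator rank of A: rr(A) ≤ gr(A). -/
/-- The entries of the tuple `a` generate `A` as a C*-algebra: the smallest closed
`*`-subalgebra of `A` containing them is `A` itself. -/
def Generates {A : Type*} [NonUnitalCStarAlgebra A] {k : ℕ} (a : Fin k → A) : Prop :=
  (NonUnitalStarAlgebra.adjoin ℂ (Set.range a)).topologicalClosure = ⊤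

section CStar

variable {B : Type*} [CStarAlgebra B] [PartialOrder B] [StarOrderedRing B]

/-- The elements `x` for which `star x * x` is dominated by a nonnegative multiple of `s` are
closed under addition. -/
lemma star_mul_self_add_le {s x y : B} (hx : ∃ C : ℝ, 0 ≤ C ∧ star x * x ≤ C • s)
    (hy : ∃ C : ℝ, 0 ≤ C ∧ star y * y ≤ C • s) :
    ∃ C : ℝ, 0 ≤ C ∧ star (x + y) * (x + y) ≤ C • s := by
  obtain ⟨C, hC, hx⟩ := hx
  obtain ⟨D, hD, hy⟩ := hy
  refine ⟨2 * (C + D), by positivity, ?_⟩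
  calc star (x + y) * (x + y)
      ≤ star (x + y) * (x + y) + star (x - y) * (x - y) :=
        le_add_of_nonneg_right (star_mul_self_nonneg _)
    _ = (star x * x + star y * y) + (star x * x + star y * y) := by
        simp only [star_add, star_sub]; noncomm_ring
    _ ≤ (C • s + D • s) + (C • s + D • s) := by gcongr
    _ = (2 * (C + D)) • s := by module

/-- The elements `x` for which `star x * x` is dominated by a nonnegative multiple of `s` are
closed under multiplication from the left. -/
lemma star_mul_self_mul_le {s y : B} (x : B) (hy : ∃ C : ℝ, 0 ≤ C ∧ star y * y ≤ C • s) :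
    ∃ C : ℝ, 0 ≤ C ∧ star (x * y) * (x * y) ≤ C • s := by
  obtain ⟨C, hC, hy⟩ := hy
  refine ⟨‖star x * x‖ * C, by positivity, ?_⟩
  calc star (x * y) * (x * y) = star y * (star x * x) * y := by
        simp only [star_mul, mul_assoc]
    _ ≤ ‖star x * x‖ • (star y * y) := CStarAlgebra.star_left_conjugate_le_norm_smul
    _ ≤ ‖star x * x‖ • C • s := smul_le_smul_of_nonneg_left hy (norm_nonneg _)
    _ = (‖star x * x‖ * C) • s := smul_smul _ _ _

/-- If `star x * x` is dominated by a multiple of `s` and `x` is invertible, then so is `s`. -/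
lemma isUnit_of_star_mul_self_le {s x : B} (hx : IsUnit x)
    (h : ∃ C : ℝ, 0 ≤ C ∧ star x * x ≤ C • s) : IsUnit s := by
  obtain ⟨C, hC, h⟩ := h
  rcases hC.eq_or_lt with rfl | hC
  · have hu : IsUnit (star x * x) := hx.star.mul hx
    have h0 : star x * x = 0 := le_antisymm (by simpa using h) (star_mul_self_nonneg x)
    rw [h0, isUnit_zero_iff] at hu
    have : Subsingleton B := subsingleton_of_zero_eq_one hu
    exact isUnit_of_subsingleton s
  · have hu : IsUnit (C • s) := CStarAlgebra.isUnit_of_le (star x * x) h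
      (IsStrictlyPositive.iff_of_unital.mpr ⟨star_mul_self_nonneg x, hx.star.mul hx⟩)
    simpa using (isUnit_smul_iff (Units.mk0 C hC.ne') s).mp hu

/-- If self-adjoint elements generate a unital C*-algebra as a (non-unital) C*-algebra,
then the sum of their squares is invertible. -/
lemma Generates.isUnit_sum_sq {k : ℕ} {b : Fin k → B} (hb : ∀ i, IsSelfAdjoint (b i))
    (hg : Generates b) : IsUnit (∑ i, b i ^ 2) := by
  have key : ∀ x ∈ NonUnitalStarAlgebra.adjoin ℂ (Set.range b),
      (∃ C : ℝ, 0 ≤ C ∧ star x * x ≤ C • ∑ i, b i ^ 2) ∧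
      ∃ C : ℝ, 0 ≤ C ∧ star (star x) * star x ≤ C • ∑ i, b i ^ 2 := by
    intro x hx
    induction hx using NonUnitalStarAlgebra.adjoin_induction with
    | mem x hx =>
      obtain ⟨i, rfl⟩ := hx
      have h : ∃ C : ℝ, 0 ≤ C ∧ star (b i) * b i ≤ C • ∑ i, b i ^ 2 := by
        refine ⟨1, zero_le_one, ?_⟩
        rw [one_smul, (hb i).star_eq, ← sq]
        exact Finset.single_le_sum (f := fun i => b i ^ 2)
          (fun j _ => (hb j).sq_nonneg) (Finset.mem_univ i)
      exact ⟨h, by rwa [(hb i).star_eq]⟩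
    | add x y _ _ hx hy =>
      refine ⟨star_mul_self_add_le hx.1 hy.1, ?_⟩
      rw [star_add x y]
      exact star_mul_self_add_le hx.2 hy.2
    | zero => exact ⟨⟨0, le_rfl, by simp⟩, ⟨0, le_rfl, by simp⟩⟩
    | mul x y _ _ hx hy =>
      refine ⟨star_mul_self_mul_le x hy.1, ?_⟩
      rw [star_mul x y]
      exact star_mul_self_mul_le _ hx.2
    | smul r x _ hx =>
      refine ⟨?_, ?_⟩
      · rw [← smul_one_mul r x]
        exact star_mul_self_mul_le _ hx.1
      · rw [star_smul r x, ← smul_one_mul (star r) (star x)]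
        exact star_mul_self_mul_le _ hx.2
    | star x _ hx => exact ⟨hx.2, by simpa only [star_star] using hx.1⟩
  have h1 : (1 : B) ∈ closure (NonUnitalStarAlgebra.adjoin ℂ (Set.range b) : Set B) := by
    have h : (1 : B) ∈ (NonUnitalStarAlgebra.adjoin ℂ (Set.range b)).topologicalClosure :=
      hg.symm ▸ NonUnitalStarAlgebra.mem_top
    exact h
  obtain ⟨x, hxu, hx⟩ := mem_closure_iff.mp h1 {x | IsUnit x} Units.isOpen isUnit_one
  exact isUnit_of_star_mul_self_le hxu (key x hx).1

end CStar

/-- For a C*-algebra `A` with minimal unitization `Ã` and `k ≥ 1`: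
if `Gen_k(Ã)_sa` is dense in `Ã^k_sa`, then `Lg_k(Ã)_sa` is dense in `Ã^k_sa`.
In other words, `rr(A) ≤ gr(A)`. -/
theorem rr_le_gr {A : Type*} [NonUnitalCStarAlgebra A] {k : ℕ} (hk : 1 ≤ k)
    (h : ∀ a : Fin k → Unitization ℂ A, (∀ i, IsSelfAdjoint (a i)) →
      a ∈ closure {b : Fin k → Unitization ℂ A | (∀ i, IsSelfAdjoint (b i)) ∧ Generates b}) :
    ∀ a : Fin k → Unitization ℂ A, (∀ i, IsSelfAdjoint (a i)) →
      a ∈ closure {b : Fin k → Unitization ℂ A |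
        (∀ i, IsSelfAdjoint (b i)) ∧ IsUnit (∑ i, b i ^ 2)} := by
  let : PartialOrder (Unitization ℂ A) := CStarAlgebra.spectralOrder _
  have : StarOrderedRing (Unitization ℂ A) := CStarAlgebra.spectralOrderedRing _
  intro a ha
  refine closure_mono ?_ (h a ha)
  rintro b ⟨hb, hg⟩
  exact ⟨hb, hg.isUnit_sum_sq hb⟩
end

section
/- Let A be a C*-algebra and let J be a closed two-sided ideal of A, regarded as a C*-algebra in its own right. Then gr(J) ≤ gr(A); that is, for every k ≥ 1, if Gen_k(Ã)_sa is dense in Ã^k_sa, then Gen_k(J̃)_sa is dense in J̃^k_sa, where à and J̃ denote the respective minimal unitizations. -/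
open Filter Topology NonUnitalStarAlgebra

section PolynomialFunctions

variable {B : Type*} [CStarAlgebra B] {ι : Type*}

/-- The noncommutative `*`-polynomial functions without constant term in the entries of a tuple
indexed by `ι`. -/
noncomputable def starPolyFun (ι B : Type*) [CStarAlgebra B] :
    NonUnitalStarSubalgebra ℂ ((ι → B) → B) :=
  adjoin ℂ (Set.range fun (i : ι) (b : ι → B) ↦ b i)

/-- Evaluation of functions at a point, as a `*`-homomorphism. -/
noncomputable def evalStarHom (X B : Type*) [CStarAlgebra B] (b : X) : (X → B) →⋆ₙₐ[ℂ] B where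
  toFun F := F b
  map_smul' _ _ := rfl
  map_zero' := rfl
  map_add' _ _ := rfl
  map_mul' _ _ := rfl
  map_star' _ := rfl

lemma map_evalStarHom_starPolyFun (b : ι → B) :
    (starPolyFun ι B).map (evalStarHom (ι → B) B b) = adjoin ℂ (Set.range b) := by
  rw [starPolyFun, NonUnitalStarAlgHom.map_adjoin, ← Set.range_comp]
  rfl

lemma apply_mem_adjoin_range {F : (ι → B) → B} (hF : F ∈ starPolyFun ι B) (b : ι → B) :
    F b ∈ adjoin ℂ (Set.range b) := by
  rw [← map_evalStarHom_starPolyFun b]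
  exact ⟨F, hF, rfl⟩

lemma exists_starPolyFun_apply_eq {b : ι → B} {z : B} (hz : z ∈ adjoin ℂ (Set.range b)) :
    ∃ F ∈ starPolyFun ι B, F b = z := by
  rw [← map_evalStarHom_starPolyFun b] at hz
  exact hz

lemma continuous_of_mem_starPolyFun {F : (ι → B) → B} (hF : F ∈ starPolyFun ι B) :
    Continuous F := by
  induction hF using adjoin_induction with
  | mem _ h => obtain ⟨i, rfl⟩ := h; exact continuous_apply i
  | add _ _ _ _ h₁ h₂ => exact h₁.add h₂
  | zero => exact continuous_const
  | mul _ _ _ _ h₁ h₂ => exact h₁.mul h₂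
  | smul r _ _ h => exact h.const_smul r
  | star _ _ h => exact h.star

lemma map_apply_eq_of_mem_starPolyFun (χ : B →⋆ₐ[ℂ] ℂ) {b b' : ι → B}
    (h : ∀ i, χ (b i) = χ (b' i)) {F : (ι → B) → B} (hF : F ∈ starPolyFun ι B) :
    χ (F b) = χ (F b') := by
  induction hF using adjoin_induction with
  | mem _ hx => obtain ⟨i, rfl⟩ := hx; exact h i
  | add _ _ _ _ h₁ h₂ => simp [h₁, h₂]
  | zero => rfl
  | mul _ _ _ _ h₁ h₂ => simp [h₁, h₂]
  | smul r _ _ h => simp [h]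
  | star _ _ h => simp [h, map_star]

lemma exists_bound_of_mem_starPolyFun (R : ℝ) {F : (ι → B) → B} (hF : F ∈ starPolyFun ι B) :
    ∃ M, ∀ b : ι → B, (∀ i, ‖b i‖ ≤ R) → ‖F b‖ ≤ M := by
  induction hF using adjoin_induction with
  | mem _ hx => obtain ⟨i, rfl⟩ := hx; exact ⟨R, fun b hb ↦ hb i⟩
  | add _ _ _ _ h₁ h₂ =>
    obtain ⟨M₁, h₁⟩ := h₁
    obtain ⟨M₂, h₂⟩ := h₂
    exact ⟨M₁ + M₂, fun b hb ↦ norm_add_le_of_le (h₁ b hb) (h₂ b hb)⟩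
  | zero => exact ⟨0, fun b _ ↦ by simp⟩
  | mul _ _ _ _ h₁ h₂ =>
    obtain ⟨M₁, h₁⟩ := h₁
    obtain ⟨M₂, h₂⟩ := h₂
    exact ⟨M₁ * M₂, fun b hb ↦ norm_mul_le_of_le (h₁ b hb) (h₂ b hb)⟩
  | smul r _ _ h =>
    obtain ⟨M, h⟩ := h
    exact ⟨‖r‖ * M, fun b hb ↦ (norm_smul_le _ _).trans
      (mul_le_mul_of_nonneg_left (h b hb) (norm_nonneg r))⟩
  | star _ _ h =>
    obtain ⟨M, h⟩ := h
    exact ⟨M, fun b hb ↦ by simpa using h b hb⟩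

/-- Left strict convergence on a left ideal is preserved by `*`-polynomial functions, provided the
tuples are self-adjoint and bounded. -/
lemma tendsto_mul_of_mem_starPolyFun {I : Set B} (hI : ∀ a, ∀ x ∈ I, a * x ∈ I)
    {α : Type*} {l : Filter α} {b' : α → ι → B} {b : ι → B} (hb : ∀ i, IsSelfAdjoint (b i))
    (hb' : ∀ᶠ e in l, ∀ i, IsSelfAdjoint (b' e i)) {R : ℝ} (hR : ∀ᶠ e in l, ∀ i, ‖b' e i‖ ≤ R)
    (hlim : ∀ i, ∀ x ∈ I, Tendsto (fun e ↦ b' e i * x) l (𝓝 (b i * x)))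
    {F : (ι → B) → B} (hF : F ∈ starPolyFun ι B) {x : B} (hx : x ∈ I) :
    Tendsto (fun e ↦ F (b' e) * x) l (𝓝 (F b * x)) := by
  have key : ∀ F G : (ι → B) → B, F ∈ starPolyFun ι B →
      (∀ x ∈ I, Tendsto (fun e ↦ F (b' e) * x) l (𝓝 (F b * x))) →
      (∀ x ∈ I, Tendsto (fun e ↦ G (b' e) * x) l (𝓝 (G b * x))) →
      ∀ x ∈ I, Tendsto (fun e ↦ (F * G) (b' e) * x) l (𝓝 ((F * G) b * x)) := by
    intro F G hF hFl hGl x hx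
    obtain ⟨M, hM⟩ := exists_bound_of_mem_starPolyFun R hF
    have h₁ : Tendsto (fun e ↦ F (b' e) * (G (b' e) * x - G b * x)) l (𝓝 0) := by
      refine isBoundedUnder_le_mul_tendsto_zero ⟨M, ?_⟩ ?_
      · simp only [eventually_map]
        filter_upwards [hR] with e he using hM _ he
      · simpa using (hGl x hx).sub_const (G b * x)
    have h₂ := h₁.add (hFl (G b * x) (hI _ _ hx))
    simpa [mul_sub, mul_assoc] using h₂
  suffices (∀ x ∈ I, Tendsto (fun e ↦ F (b' e) * x) l (𝓝 (F b * x))) ∧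
      ∀ x ∈ I, Tendsto (fun e ↦ (star F) (b' e) * x) l (𝓝 ((star F) b * x)) from this.1 x hx
  clear hx x
  induction hF using adjoin_induction with
  | mem _ h =>
    obtain ⟨i, rfl⟩ := h
    refine ⟨hlim i, fun x hx ↦ ?_⟩
    simp only [Pi.star_apply, (hb i).star_eq]
    refine (hlim i x hx).congr' ?_
    filter_upwards [hb'] with e he
    rw [(he i).star_eq]
  | add F G _ _ h₁ h₂ =>
    refine ⟨fun x hx ↦ ?_, fun x hx ↦ ?_⟩
    · simpa [add_mul] using (h₁.1 x hx).add (h₂.1 x hx)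
    · simpa [add_mul] using (h₁.2 x hx).add (h₂.2 x hx)
  | zero => simp [tendsto_const_nhds]
  | mul F G hF hG h₁ h₂ =>
    refine ⟨key F G hF h₁.1 h₂.1, ?_⟩
    rw [star_mul]
    exact key _ _ (star_mem hG) h₂.2 h₁.2
  | smul r F _ h =>
    refine ⟨fun x hx ↦ ?_, fun x hx ↦ ?_⟩
    · simpa using (h.1 x hx).const_smul r
    · simpa using (h.2 x hx).const_smul (star r)
  | star F _ h => exact ⟨h.2, by simpa using h.1⟩

end PolynomialFunctions

section Truncation

variable {B : Type*} [CStarAlgebra B]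

lemma pow_succ_mem_of_mem {M S : Type*} [Monoid M] [SetLike S M] [MulMemClass S M] {s : S} {w : M}
    (hw : w ∈ s) (n : ℕ) : w ^ (n + 1) ∈ s := by
  induction n with
  | zero => simpa
  | succ n ih => rw [pow_succ]; exact mul_mem ih hw

/-- There is a real polynomial vanishing at `0` which is bounded by `M + η` on `[-R, R]` and
close to the identity on `[-M, M]`. -/
lemma exists_polynomial_truncation {M η : ℝ} (R : ℝ) (hM : 0 ≤ M) (hη : 0 < η) :
    ∃ p : Polynomial ℝ, p.coeff 0 = 0 ∧ (∀ t, |t| ≤ R → |p.eval t| ≤ M + η) ∧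
      ∀ t, |t| ≤ R → |t| ≤ M → |p.eval t - t| ≤ η := by
  obtain hR | hR := lt_or_ge R 0
  · exact ⟨0, by simp, fun t ht ↦ absurd (abs_nonneg t) (by linarith),
      fun t ht ↦ absurd (abs_nonneg t) (by linarith)⟩
  obtain ⟨q, hq⟩ := exists_polynomial_near_of_continuousOn (-R) R
    (fun t ↦ max (-M) (min t M)) (by fun_prop) (η / 2) (by positivity)
  have h0 := hq 0 ⟨by linarith, hR⟩
  have hq0 : |q.eval 0| < η / 2 := by simpa [hM] using h0
  refine ⟨q - Polynomial.C (q.eval 0), by simp [Polynomial.coeff_zero_eq_eval_zero],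
    fun t ht ↦ ?_, fun t ht htM ↦ ?_⟩
  · have h := hq t (abs_le.1 ht)
    have hc : |max (-M) (min t M)| ≤ M := by
      rw [abs_le]
      exact ⟨le_max_left _ _, max_le (by linarith) (min_le_right _ _)⟩
    simp only [Polynomial.eval_sub, Polynomial.eval_C]
    rw [abs_lt] at h hq0
    rw [abs_le] at hc ⊢
    constructor <;> linarith
  · have h := hq t (abs_le.1 ht)
    have hc : max (-M) (min t M) = t := by
      rw [abs_le] at htM
      rw [min_eq_left htM.2, max_eq_right htM.1]
    rw [hc] at h
    simp only [Polynomial.eval_sub, Polynomial.eval_C]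
    rw [abs_lt] at h hq0
    rw [abs_le]
    constructor <;> linarith

lemma abs_le_norm_of_mem_spectrum {w : B} {t : ℝ} (ht : t ∈ spectrum ℝ w) : |t| ≤ ‖w‖ := by
  obtain h | h := subsingleton_or_nontrivial B
  · simp [spectrum.of_subsingleton] at ht
  · simpa using spectrum.norm_le_norm_of_mem ht

lemma norm_aeval_le {w : B} (hw : IsSelfAdjoint w) {p : Polynomial ℝ} {C : ℝ} (hC : 0 ≤ C)
    (h : ∀ t, |t| ≤ ‖w‖ → |p.eval t| ≤ C) : ‖Polynomial.aeval w p‖ ≤ C := by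
  rw [← cfc_polynomial p w]
  exact norm_cfc_le hC fun t ht ↦ h t (abs_le_norm_of_mem_spectrum ht)

variable {ι : Type*}

/-- A self-adjoint element of the C*-algebra generated by `b` can be approximated by
`*`-polynomials in `b` which satisfy a norm bound on all tuples of norm at most `R`
that does not depend on `R`. -/
lemma exists_starPolyFun_bounded {b : ι → B} {R : ℝ}
    (hbR : ∀ i, ‖b i‖ ≤ R) {c : B} (hc : IsSelfAdjoint c)
    (hcb : c ∈ closure (adjoin ℂ (Set.range b) : Set B)) {δ : ℝ} (hδ : 0 < δ) :
    ∃ F ∈ starPolyFun ι B, ‖F b - c‖ < δ ∧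
      ∀ b' : ι → B, (∀ i, ‖b' i‖ ≤ R) → ‖F b'‖ ≤ ‖c‖ + 1 := by
  set η := min (δ / 2) (1 / 2) with hη
  have hη0 : 0 < η := by positivity
  have hη1 : η ≤ δ / 2 := min_le_left _ _
  have hη2 : η ≤ 1 / 2 := min_le_right _ _
  obtain ⟨z, hz, hzc⟩ := Metric.mem_closure_iff.1 hcb η hη0
  obtain ⟨G, hG, rfl⟩ := exists_starPolyFun_apply_eq hz
  set H : (ι → B) → B := (2⁻¹ : ℂ) • (G + star G) with hH
  have hHmem : H ∈ starPolyFun ι B := SMulMemClass.smul_mem _ (add_mem hG (star_mem hG))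
  have hHsa : ∀ b', IsSelfAdjoint (H b') := fun b' ↦ by
    simp [H, IsSelfAdjoint, add_comm]
  have hHc : ‖H b - c‖ < η := by
    have h1 : ‖G b - c‖ < η := by rwa [← dist_eq_norm, dist_comm]
    have h2 : ‖star (G b) - c‖ < η := by
      rwa [← hc.star_eq, ← star_sub, norm_star]
    have : H b - c = (2⁻¹ : ℂ) • ((G b - c) + (star (G b) - c)) := by
      simp only [H, Pi.smul_apply, Pi.add_apply, Pi.star_apply, smul_add, smul_sub]
      have : c = (2⁻¹ : ℂ) • c + (2⁻¹ : ℂ) • c := by rw [← add_smul]; norm_num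
      nth_rewrite 1 [this]
      abel
    rw [this, norm_smul]
    have := norm_add_le (G b - c) (star (G b) - c)
    norm_num
    linarith
  obtain ⟨R', hR'⟩ := exists_bound_of_mem_starPolyFun R hHmem
  obtain ⟨p, hp0, hp1, hp2⟩ :=
    exists_polynomial_truncation R' (M := ‖c‖ + η) (by positivity) hη0
  refine ⟨fun b' ↦ Polynomial.aeval (H b') p, ?_, ?_, fun b' hb' ↦ ?_⟩
  · have : (fun b' ↦ Polynomial.aeval (H b') p) =
        p.sum fun n r ↦ (r : ℂ) • H ^ n := by
      ext b'
      simp [Polynomial.aeval_eq_sum_range, Polynomial.sum_over_range, Finset.sum_apply]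
    rw [this, Polynomial.sum]
    refine sum_mem fun n hn ↦ SMulMemClass.smul_mem _ ?_
    obtain _ | n := n
    · simp [hp0] at hn
    · exact pow_succ_mem_of_mem hHmem n
  · have h1 : ‖Polynomial.aeval (H b) (p - Polynomial.X)‖ ≤ η := by
      refine norm_aeval_le (hHsa b) hη0.le fun t ht ↦ ?_
      simp only [Polynomial.eval_sub, Polynomial.eval_X]
      refine hp2 t (ht.trans (hR' b hbR)) (ht.trans ?_)
      have := norm_add_le (H b - c) c
      rw [sub_add_cancel] at this
      linarith
    rw [map_sub, Polynomial.aeval_X] at h1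
    have := norm_add_le (Polynomial.aeval (H b) p - H b) (H b - c)
    rw [sub_add_sub_cancel] at this
    linarith
  · refine norm_aeval_le (hHsa b') (by positivity) fun t ht ↦ ?_
    have := hp1 t (ht.trans (hR' b' hb'))
    linarith

end Truncation

section IdealUnitization

variable {B : Type*} [CStarAlgebra B]

lemma norm_apply_le_of_character (χ : B →⋆ₐ[ℂ] ℂ) (b : B) : ‖χ b‖ ≤ ‖b‖ :=
  NonUnitalStarAlgHom.norm_apply_le χ b

lemma norm_algebraMap_le (r : ℂ) : ‖algebraMap ℂ B r‖ ≤ ‖r‖ := by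
  obtain h | h := subsingleton_or_nontrivial B
  · simp [Subsingleton.elim (algebraMap ℂ B r) 0]
  · simp

/-- The `*`-algebra `I + ℂ 1` for an ideal `I` in the kernel of the character `χ`. -/
def idealAddScalars (I : NonUnitalStarSubalgebra ℂ B)
    (hI : ∀ a : B, ∀ x ∈ I, a * x ∈ I ∧ x * a ∈ I) (χ : B →⋆ₐ[ℂ] ℂ) :
    NonUnitalStarSubalgebra ℂ B where
  carrier := {b | b - algebraMap ℂ B (χ b) ∈ I}
  add_mem' {a b} (ha : a - _ ∈ I) (hb : b - _ ∈ I) := by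
    have := add_mem ha hb
    rwa [sub_add_sub_comm, ← map_add, ← map_add] at this
  zero_mem' := by simp
  mul_mem' {a b} (ha : a - _ ∈ I) (hb : b - _ ∈ I) := by
    have h1 : a * b - algebraMap ℂ B (χ (a * b)) = (a - algebraMap ℂ B (χ a)) * b +
        χ a • (b - algebraMap ℂ B (χ b)) := by
      simp only [map_mul, Algebra.smul_def]
      noncomm_ring
    change _ ∈ I
    rw [h1]
    exact add_mem (hI _ _ ha).2 (SMulMemClass.smul_mem _ hb)
  smul_mem' r {b} (hb : b - _ ∈ I) := by
    have := SMulMemClass.smul_mem r hb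
    simpa [smul_sub, Algebra.algebraMap_eq_smul_one, mul_smul] using this
  star_mem' {b} (hb : b - _ ∈ I) := by
    have := star_mem hb
    rwa [star_sub, ← algebraMap_star_comm, ← map_star] at this

variable {I : NonUnitalStarSubalgebra ℂ B} {hI : ∀ a : B, ∀ x ∈ I, a * x ∈ I ∧ x * a ∈ I}
  {χ : B →⋆ₐ[ℂ] ℂ}

lemma mem_idealAddScalars {b : B} :
    b ∈ idealAddScalars I hI χ ↔ b - algebraMap ℂ B (χ b) ∈ I := Iff.rfl

lemma isClosed_idealAddScalars (hIc : IsClosed (I : Set B)) :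
    IsClosed (idealAddScalars I hI χ : Set B) := by
  refine hIc.preimage (f := fun b ↦ b - algebraMap ℂ B (χ b)) ?_
  have : Continuous χ := map_continuous χ
  fun_prop

lemma exists_approximateUnit (hIc : IsClosed (I : Set B)) :
    ∃ l : Filter B, l.NeBot ∧ (∀ᶠ e in l, e ∈ I ∧ IsSelfAdjoint e ∧ ‖e‖ ≤ 1) ∧
      ∀ x ∈ I, Tendsto (fun e ↦ e * x) l (𝓝 x) := by
  have : IsClosed (I : Set B) := hIc
  let _ : PartialOrder I := CStarAlgebra.spectralOrder I
  have : StarOrderedRing I := CStarAlgebra.spectralOrderedRing I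
  have hu := CStarAlgebra.increasingApproximateUnit I
  refine ⟨(CStarAlgebra.approximateUnit I).map (↑), inferInstance, ?_, fun x hx ↦ ?_⟩
  · rw [eventually_map]
    filter_upwards [hu.eventually_isSelfAdjoint, hu.eventually_norm] with e h1 h2
    exact ⟨e.2, congrArg Subtype.val h1.star_eq, h2⟩
  · rw [tendsto_map'_iff]
    exact (continuous_subtype_val.tendsto _).comp (hu.tendsto_mul_right ⟨x, hx⟩)

/-- Cut-off: a self-adjoint tuple `b` close to the self-adjoint tuple `a` in `I + ℂ 1` can be
approximated, strictly relative to `I`, by tuples in `I + ℂ 1` close to `a`. -/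
lemma exists_cutoff (hIc : IsClosed (I : Set B)) (hχ : ∀ x ∈ I, χ x = 0) {ι : Type*}
    {a b : ι → B} (ha : ∀ i, IsSelfAdjoint (a i)) (haI : ∀ i, a i ∈ idealAddScalars I hI χ)
    (hb : ∀ i, IsSelfAdjoint (b i)) :
    ∃ (l : Filter B) (b' : B → ι → B), l.NeBot ∧
      (∀ᶠ e in l, ∀ i, IsSelfAdjoint (b' e i) ∧ b' e i ∈ idealAddScalars I hI χ ∧
        χ (b' e i) = χ (b i) ∧ ‖b' e i - a i‖ ≤ 3 * ‖b i - a i‖) ∧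
      ∀ i, ∀ x ∈ I, Tendsto (fun e ↦ b' e i * x) l (𝓝 (b i * x)) := by
  obtain ⟨l, hl, hle, hlim⟩ := exists_approximateUnit hIc
  set d : ι → B := fun i ↦ (b i - a i) - algebraMap ℂ B (χ (b i - a i)) with hd
  have hdsa : ∀ i, IsSelfAdjoint (d i) := fun i ↦ by
    have h := (hb i).sub (ha i)
    refine h.sub ?_
    rw [IsSelfAdjoint, ← algebraMap_star_comm, ← map_star, h.star_eq]
  have hdn : ∀ i, ‖d i‖ ≤ 2 * ‖b i - a i‖ := fun i ↦ by
    have h1 := norm_sub_le (b i - a i) (algebraMap ℂ B (χ (b i - a i)))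
    have h2 := norm_algebraMap_le (B := B) (χ (b i - a i))
    have h3 := norm_apply_le_of_character χ (b i - a i)
    linarith
  refine ⟨l, fun e i ↦ b i - d i + e * d i * e, hl, ?_, fun i x hx ↦ ?_⟩
  · filter_upwards [hle] with e ⟨heI, hes, hen⟩ i
    have hede : e * d i * e ∈ I := (hI _ _ heI).1
    have hχd : χ (d i) = 0 := by simp [d, AlgHomClass.commutes]
    have hbd : b i - d i = a i + algebraMap ℂ B (χ (b i - a i)) := by simp only [d]; abel
    have hχb : χ (b i - d i + e * d i * e) = χ (b i) := by
      rw [map_add, hχ _ hede, map_sub, hχd]; simp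
    refine ⟨((hb i).sub (hdsa i)).add ?_, ?_, hχb, ?_⟩
    · simpa [hes.star_eq] using (hdsa i).conjugate e
    · rw [mem_idealAddScalars, hχb, hbd]
      have : a i + algebraMap ℂ B (χ (b i - a i)) + e * d i * e - algebraMap ℂ B (χ (b i)) =
          (a i - algebraMap ℂ B (χ (a i))) + e * d i * e := by
        simp only [map_sub]; abel
      rw [this]
      exact add_mem (haI i) hede
    · have h1 : ‖e * d i * e‖ ≤ ‖d i‖ := by
        calc ‖e * d i * e‖ ≤ ‖e‖ * ‖d i‖ * ‖e‖ := norm_mul₃_le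
          _ ≤ 1 * ‖d i‖ * 1 := by gcongr
          _ = ‖d i‖ := by ring
      have h2 := norm_algebraMap_le (B := B) (χ (b i - a i))
      have h3 := norm_apply_le_of_character χ (b i - a i)
      have h4 : b i - d i + e * d i * e - a i =
          algebraMap ℂ B (χ (b i - a i)) + e * d i * e := by rw [hbd]; abel
      rw [h4]
      have h5 := norm_add_le (algebraMap ℂ B (χ (b i - a i))) (e * d i * e)
      have h6 := hdn i
      linarith
  · have h1 : Tendsto (fun e ↦ e * d i * (e * x - x)) l (𝓝 0) := by
      refine isBoundedUnder_le_mul_tendsto_zero ⟨‖d i‖, ?_⟩ ?_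
      · simp only [eventually_map]
        filter_upwards [hle] with e ⟨_, _, hen⟩
        calc ‖e * d i‖ ≤ ‖e‖ * ‖d i‖ := norm_mul_le _ _
          _ ≤ 1 * ‖d i‖ := by gcongr
          _ = ‖d i‖ := one_mul _
      · simpa using (hlim x hx).sub_const x
    have h2 := (h1.add (hlim (d i * x) (hI _ _ hx).1)).const_add ((b i - d i) * x)
    refine (h2.congr fun e ↦ ?_).trans_eq ?_
    · noncomm_ring
    · congr 1; noncomm_ring

/-- If the closure of a `*`-algebra generated by a tuple is everything, then the character does not
vanish on the whole tuple. -/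
lemma exists_character_ne_zero {ι : Type*} {b : ι → B}
    (h : (adjoin ℂ (Set.range b)).topologicalClosure = ⊤) : ∃ i, χ (b i) ≠ 0 := by
  by_contra! hb
  let K : NonUnitalStarSubalgebra ℂ B :=
    NonUnitalStarSubalgebra.comap (χ : B →⋆ₙₐ[ℂ] ℂ) ⊥
  have hK : ∀ x, x ∈ K ↔ χ x = 0 := fun x ↦ by
    change χ x ∈ (⊥ : NonUnitalStarSubalgebra ℂ ℂ) ↔ _
    exact mem_bot
  have h1 : (adjoin ℂ (Set.range b)).topologicalClosure ≤ K := by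
    refine NonUnitalStarSubalgebra.topologicalClosure_minimal _ ?_ ?_
    · rw [adjoin_le_iff]
      rintro _ ⟨i, rfl⟩
      exact (hK _).2 (hb i)
    · have : (K : Set B) = χ ⁻¹' {0} := by ext x; exact hK x
      rw [this]
      exact isClosed_singleton.preimage (map_continuous χ)
  have h2 : (1 : B) ∈ K := h1 (by rw [h]; exact mem_top)
  rw [hK, map_one] at h2
  exact one_ne_zero h2

/-- Elements in the kernel of a character that does not vanish on the tuple are approximated by
elements of the generated `*`-algebra in the kernel. -/
lemma exists_adjoin_character_eq_zero {ι : Type*} {b : ι → B} {i : ι} (hi : χ (b i) ≠ 0) {h : B}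
    (hh : h ∈ closure (adjoin ℂ (Set.range b) : Set B)) (hh0 : χ h = 0) {δ : ℝ} (hδ : 0 < δ) :
    ∃ z ∈ adjoin ℂ (Set.range b), χ z = 0 ∧ ‖z - h‖ < δ := by
  have hχc : Continuous χ := map_continuous χ
  set T : B → B := fun z ↦ z - (χ z / χ (b i)) • b i
  have hTc : Continuous T := by fun_prop
  have hTh : T h = h := by simp [T, hh0]
  have h1 : h ∈ closure {z | z ∈ adjoin ℂ (Set.range b) ∧ χ z = 0} := by
    rw [← hTh]
    refine map_mem_closure hTc hh fun z hz ↦ ⟨?_, ?_⟩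
    · exact sub_mem hz (SMulMemClass.smul_mem _ (subset_adjoin ℂ _ ⟨i, rfl⟩))
    · simp [T, hi]
  obtain ⟨z, ⟨hz, hz0⟩, hd⟩ := Metric.mem_closure_iff.1 h1 δ hδ
  exact ⟨z, hz, hz0, by rwa [← dist_eq_norm, dist_comm]⟩

variable {k : ℕ}

/-- The property that generating self-adjoint `k`-tuples are dense among self-adjoint ones. -/
def DenseGenerators (k : ℕ) (B : Type*) [CStarAlgebra B] : Prop :=
  ∀ a : Fin k → B, (∀ i, IsSelfAdjoint (a i)) →
    a ∈ closure {b : Fin k → B | (∀ i, IsSelfAdjoint (b i)) ∧ Generates b}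

lemma DenseGenerators.exists_norm_sub_lt (hB : DenseGenerators k B) {a : Fin k → B}
    (ha : ∀ i, IsSelfAdjoint (a i)) {ε : ℝ} (hε : 0 < ε) :
    ∃ b : Fin k → B, (∀ i, IsSelfAdjoint (b i)) ∧ Generates b ∧ ∀ i, ‖b i - a i‖ < ε := by
  obtain ⟨b, ⟨hb, hg⟩, hd⟩ := Metric.mem_closure_iff.1 (hB a ha) ε hε
  refine ⟨b, hb, hg, fun i ↦ ?_⟩
  rw [← dist_eq_norm, dist_comm]
  exact (dist_le_pi_dist a b i).trans_lt hd

lemma Generates.mem_closure {b : Fin k → B} (h : Generates b) (z : B) :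
    z ∈ closure (adjoin ℂ (Set.range b) : Set B) := by
  change z ∈ (adjoin ℂ (Set.range b)).topologicalClosure
  rw [h]
  exact mem_top

/-- Tuples whose generated algebra contains local units in `I` are dense. -/
lemma exists_adjoin_local_unit (hIc : IsClosed (I : Set B)) (hχ : ∀ x ∈ I, χ x = 0)
    (hB : DenseGenerators k B) {a : Fin k → B} (ha : ∀ i, IsSelfAdjoint (a i))
    (haI : ∀ i, a i ∈ idealAddScalars I hI χ) {c : B} (hc : c ∈ I) {ε : ℝ} (hε : 0 < ε) :
    ∃ b : Fin k → B, (∀ i, IsSelfAdjoint (b i) ∧ b i ∈ idealAddScalars I hI χ ∧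
      ‖b i - a i‖ < ε) ∧ ∃ h ∈ adjoin ℂ (Set.range b), h ∈ I ∧ ‖h * c - c‖ < ε := by
  obtain ⟨l₀, hl₀, hle₀, hlim₀⟩ := exists_approximateUnit hIc
  obtain ⟨h₀, ⟨hh₀I, -, -⟩, hh₀⟩ :=
    (hle₀.and ((hlim₀ c hc).eventually (Metric.ball_mem_nhds c (half_pos hε)))).exists
  rw [dist_eq_norm] at hh₀
  obtain ⟨b, hb, hg, hba⟩ := hB.exists_norm_sub_lt ha (show 0 < ε / 3 by positivity)
  obtain ⟨i, hi⟩ := exists_character_ne_zero (χ := χ) hg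
  obtain ⟨z, hz, hz0, hzh⟩ := exists_adjoin_character_eq_zero hi (hg.mem_closure h₀) (hχ _ hh₀I)
    (show 0 < ε / 2 / (‖c‖ + 1) by positivity)
  obtain ⟨F, hF, rfl⟩ := exists_starPolyFun_apply_eq hz
  obtain ⟨l, b', hl, hb', hlim⟩ := exists_cutoff (hI := hI) hIc hχ ha haI hb
  have hFc : ‖F b * c - c‖ < ε := by
    have h1 : ‖(F b - h₀) * c‖ ≤ ε / 2 := by
      calc ‖(F b - h₀) * c‖ ≤ ‖F b - h₀‖ * ‖c‖ := norm_mul_le _ _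
        _ ≤ ε / 2 / (‖c‖ + 1) * (‖c‖ + 1) := by gcongr; linarith
        _ = ε / 2 := by field_simp
    have h2 := norm_add_le ((F b - h₀) * c) (h₀ * c - c)
    have h3 : (F b - h₀) * c + (h₀ * c - c) = F b * c - c := by noncomm_ring
    rw [h3] at h2
    linarith
  have hbound : ∀ᶠ e in l, ∀ i, ‖b' e i‖ ≤ ‖a‖ + ε := by
    filter_upwards [hb'] with e he i
    have h1 := norm_add_le (b' e i - a i) (a i)
    rw [sub_add_cancel] at h1
    have := norm_le_pi_norm a i
    linarith [(he i).2.2.2, hba i]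
  have hFlim := tendsto_mul_of_mem_starPolyFun (I := (I : Set B)) (fun a x hx ↦ (hI a x hx).1) hb
    (hb'.mono fun e he i ↦ (he i).1) hbound hlim hF hc
  obtain ⟨e, he, hed⟩ :=
    (hb'.and ((hFlim.sub_const c).norm.eventually_lt_const hFc)).exists
  refine ⟨b' e, fun i ↦ ⟨(he i).1, (he i).2.1, ?_⟩, F (b' e), apply_mem_adjoin_range hF _, ?_, hed⟩
  · linarith [(he i).2.2.2, hba i]
  · have h1 : F (b' e) ∈ idealAddScalars I hI χ := by
      refine (adjoin_le_iff.2 ?_) (apply_mem_adjoin_range hF (b' e))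
      rintro _ ⟨j, rfl⟩
      exact (he j).2.1
    have h2 : χ (F (b' e)) = 0 := by
      rw [← hz0]
      exact map_apply_eq_of_mem_starPolyFun χ (fun j ↦ (he j).2.2.1) hF
    simpa [mem_idealAddScalars, h2] using h1

/-- Tuples in `I + ℂ 1` whose generated algebra approximately contains a given self-adjoint element
of `I` are dense. -/
lemma exists_adjoin_near (hIc : IsClosed (I : Set B)) (hχ : ∀ x ∈ I, χ x = 0)
    (hB : DenseGenerators k B) {a : Fin k → B} (ha : ∀ i, IsSelfAdjoint (a i))
    (haI : ∀ i, a i ∈ idealAddScalars I hI χ) {c : B} (hc : c ∈ I) (hcsa : IsSelfAdjoint c)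
    {ε : ℝ} (hε : 0 < ε) :
    ∃ b : Fin k → B, (∀ i, IsSelfAdjoint (b i) ∧ b i ∈ idealAddScalars I hI χ ∧
      ‖b i - a i‖ < ε) ∧ ∃ z ∈ adjoin ℂ (Set.range b), ‖z - c‖ < ε := by
  obtain ⟨a₁, ha₁, h₀, hh₀, hh₀I, hh₀c⟩ := exists_adjoin_local_unit (hI := hI) hIc hχ hB ha haI hc
    (show 0 < ε / 4 by positivity)
  obtain ⟨H, hH, hHh⟩ := exists_starPolyFun_apply_eq (star_mem hh₀)
  set h := star h₀ with hh
  have hhI : h ∈ I := star_mem hh₀I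
  have hhc : ‖c * h - c‖ < ε / 4 := by
    rw [← norm_star]
    simpa [h, hcsa.star_eq] using hh₀c
  obtain ⟨δ, hδ, hHδ⟩ := Metric.continuous_iff.1 (continuous_of_mem_starPolyFun hH) a₁
    (ε / 4 / (‖c‖ + 1)) (by positivity)
  obtain ⟨b, hb, hg, hba⟩ := hB.exists_norm_sub_lt (fun i ↦ (ha₁ i).1)
    (show 0 < min (δ / 6) (ε / 6) by positivity)
  obtain ⟨l, b', hl, hb', hlim⟩ := exists_cutoff (hI := hI) hIc hχ (fun i ↦ (ha₁ i).1)
    (fun i ↦ (ha₁ i).2.1) hb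
  have hclose : ∀ᶠ e in l, ∀ i, ‖b' e i - a₁ i‖ ≤ δ / 2 ∧ ‖b' e i - a₁ i‖ ≤ ε / 2 := by
    filter_upwards [hb'] with e he i
    have h1 := (he i).2.2.2
    have h2 := lt_min_iff.1 (hba i)
    constructor <;> linarith
  set R := ‖a₁‖ + ε with hR
  have hbound : ∀ᶠ e in l, ∀ i, ‖b' e i‖ ≤ R := by
    filter_upwards [hclose] with e he i
    have h1 := norm_add_le (b' e i - a₁ i) (a₁ i)
    rw [sub_add_cancel] at h1
    have := norm_le_pi_norm a₁ i
    linarith [(he i).2]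
  have hbR : ∀ i, ‖b i‖ ≤ R := fun i ↦ by
    have h1 := norm_add_le (b i - a₁ i) (a₁ i)
    rw [sub_add_cancel] at h1
    have := norm_le_pi_norm a₁ i
    linarith [(lt_min_iff.1 (hba i)).2]
  obtain ⟨F, hF, hFc, hFM⟩ := exists_starPolyFun_bounded hbR hcsa (hg.mem_closure c)
    (show 0 < ε / 4 / (‖h‖ + 1) by positivity)
  have hFlim := tendsto_mul_of_mem_starPolyFun (I := (I : Set B)) (fun a x hx ↦ (hI a x hx).1) hb
    (hb'.mono fun e he i ↦ (he i).1) hbound hlim hF hhI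
  obtain ⟨e, he, hed, hec, heR⟩ := (hb'.and
    ((hFlim.eventually (Metric.ball_mem_nhds _ (show 0 < ε / 4 by positivity))).and
      (hclose.and hbound))).exists
  rw [dist_eq_norm] at hed
  refine ⟨b' e, fun i ↦ ⟨(he i).1, (he i).2.1, ?_⟩, F (b' e) * H (b' e),
    mul_mem (apply_mem_adjoin_range hF _) (apply_mem_adjoin_range hH _), ?_⟩
  · have h1 := norm_add_le (b' e i - a₁ i) (a₁ i - a i)
    rw [sub_add_sub_cancel] at h1
    linarith [(hec i).2, (ha₁ i).2.2]
  · have h1 : ‖F (b' e) * (H (b' e) - h)‖ ≤ ε / 4 := by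
      have hd : dist (b' e) a₁ < δ := by
        refine lt_of_le_of_lt ((dist_pi_le_iff (half_pos hδ).le).2 fun i ↦ ?_) (half_lt_self hδ)
        rw [dist_eq_norm]
        exact (hec i).1
      have h2 := hHδ _ hd
      rw [hHh, dist_eq_norm] at h2
      calc ‖F (b' e) * (H (b' e) - h)‖ ≤ ‖F (b' e)‖ * ‖H (b' e) - h‖ := norm_mul_le _ _
        _ ≤ (‖c‖ + 1) * (ε / 4 / (‖c‖ + 1)) := by gcongr; exact hFM _ heR
        _ = ε / 4 := by field_simp
    have h2 : ‖(F b - c) * h‖ ≤ ε / 4 := by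
      calc ‖(F b - c) * h‖ ≤ ‖F b - c‖ * ‖h‖ := norm_mul_le _ _
        _ ≤ ε / 4 / (‖h‖ + 1) * (‖h‖ + 1) := by gcongr; linarith
        _ = ε / 4 := by field_simp
    have h3 : F (b' e) * H (b' e) - c = F (b' e) * (H (b' e) - h) + (F (b' e) * h - F b * h) +
        (F b - c) * h + (c * h - c) := by noncomm_ring
    rw [h3]
    have h4 := norm_add_le (F (b' e) * (H (b' e) - h) + (F (b' e) * h - F b * h) +
        (F b - c) * h) (c * h - c)
    have h5 := norm_add₃_le (a := F (b' e) * (H (b' e) - h)) (b := F (b' e) * h - F b * h)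
        (c := (F b - c) * h)
    linarith

lemma isSeparable_adjoin_range_closure {ι : Type*} [Countable ι] (b : ι → B) :
    TopologicalSpace.IsSeparable (closure (adjoin ℂ (Set.range b) : Set B)) := by
  refine TopologicalSpace.IsSeparable.closure ?_
  have h1 : (adjoin ℂ (Set.range b) : Set B) = Submodule.span ℂ
      (Subsemigroup.closure (Set.range b ∪ star (Set.range b)) : Set B) := by
    rw [← adjoin_eq_span]; rfl
  have h2 : (Set.range b ∪ star (Set.range b)).Countable := by
    refine (Set.countable_range b).union ?_
    rw [← Set.image_star]
    exact (Set.countable_range b).image _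
  rw [h1]
  refine (Set.Countable.isSeparable ?_).span
  have : Countable ↥(Set.range b ∪ star (Set.range b)) := h2
  have h3 : (Subsemigroup.closure (Set.range b ∪ star (Set.range b)) : Set B) ⊆
      Set.range (FreeMonoid.lift ((↑) : ↥(Set.range b ∪ star (Set.range b)) → B)) := by
    rw [← MonoidHom.coe_mrange, ← Submonoid.closure_eq_mrange]
    exact (Subsemigroup.closure_le (S := (Submonoid.closure _).toSubsemigroup)).2
      Submonoid.subset_closure
  have : Countable (FreeMonoid ↥(Set.range b ∪ star (Set.range b))) :=
    inferInstanceAs (Countable (List _))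
  exact (Set.countable_range _).mono h3

/-- Tuples generating `I + ℂ 1` are dense among the self-adjoint tuples in `I + ℂ 1`. -/
theorem DenseGenerators.exists_generating_idealAddScalars (hB : DenseGenerators k B)
    (hIc : IsClosed (I : Set B)) (hχ : ∀ x ∈ I, χ x = 0) {a : Fin k → B}
    (ha : ∀ i, IsSelfAdjoint (a i)) (haI : ∀ i, a i ∈ idealAddScalars I hI χ) {ε : ℝ}
    (hε : 0 < ε) :
    ∃ b : Fin k → B, (∀ i, IsSelfAdjoint (b i) ∧ b i ∈ idealAddScalars I hI χ) ∧
      dist a b < ε ∧ idealAddScalars I hI χ ≤ (adjoin ℂ (Set.range b)).topologicalClosure := by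
  have hχc : Continuous χ := map_continuous χ
  let X : Set (Fin k → B) := {b | ∀ i, IsSelfAdjoint (b i) ∧ b i ∈ idealAddScalars I hI χ}
  have hX : IsClosed X := by
    have : X = ⋂ i, (fun b : Fin k → B ↦ b i) ⁻¹'
        ({x | IsSelfAdjoint x} ∩ (idealAddScalars I hI χ : Set B)) := by
      ext b
      simp [X]
    rw [this]
    refine isClosed_iInter fun i ↦ IsClosed.preimage (continuous_apply i) ?_
    exact (isClosed_eq continuous_star continuous_id).inter (isClosed_idealAddScalars hIc)
  have : CompleteSpace X := hX.completeSpace_coe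
  obtain ⟨g, -, hg, -⟩ := hB.exists_norm_sub_lt ha hε
  have hsep : TopologicalSpace.IsSeparable {c | c ∈ I ∧ IsSelfAdjoint c} :=
    (isSeparable_adjoin_range_closure g).mono fun c _ ↦ hg.mem_closure c
  obtain ⟨S, hSI, hS, hSd⟩ := hsep.exists_countable_dense_subset
  have : Countable S := hS
  let U : S × ℕ → Set X := fun p ↦
    {b | ∃ z ∈ adjoin ℂ (Set.range b.1), ‖z - p.1‖ < 1 / (p.2 + 1 : ℝ)}
  have hUo : ∀ p, IsOpen (U p) := fun p ↦ by
    have : U p = ⋃ F ∈ starPolyFun (Fin k) B,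
        {b : X | ‖F b.1 - p.1‖ < 1 / (p.2 + 1 : ℝ)} := by
      ext b
      simp only [U, Set.mem_ofPred_eq, Set.mem_iUnion, exists_prop]
      constructor
      · rintro ⟨z, hz, h⟩
        obtain ⟨F, hF, rfl⟩ := exists_starPolyFun_apply_eq hz
        exact ⟨F, hF, h⟩
      · rintro ⟨F, hF, h⟩
        exact ⟨_, apply_mem_adjoin_range hF _, h⟩
    rw [this]
    refine isOpen_biUnion fun F hF ↦ isOpen_lt ?_ continuous_const
    exact (((continuous_of_mem_starPolyFun hF).comp continuous_subtype_val).sub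
      continuous_const).norm
  have hUd : ∀ p, Dense (U p) := fun p ↦ by
    refine Metric.dense_iff.2 fun x r hr ↦ ?_
    obtain ⟨b, hb, z, hz, hzc⟩ := exists_adjoin_near (hI := hI) hIc hχ hB (fun i ↦ (x.2 i).1)
      (fun i ↦ (x.2 i).2) (hSI p.1.2).1 (hSI p.1.2).2
      (show 0 < min r (1 / (p.2 + 1 : ℝ)) by positivity)
    refine ⟨⟨b, fun i ↦ ⟨(hb i).1, (hb i).2.1⟩⟩, ?_, z, hz, hzc.trans_le (min_le_right _ _)⟩
    rw [Metric.mem_ball, Subtype.dist_eq, dist_pi_lt_iff hr]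
    intro i
    rw [dist_eq_norm]
    exact (hb i).2.2.trans_le (min_le_left _ _)
  let V : Set X := {b | ∃ i, χ (b.1 i) ≠ 0}
  have hVo : IsOpen V := by
    simp only [V, Set.ofPred_exists]
    refine isOpen_iUnion fun i ↦ isOpen_ne_fun ?_ continuous_const
    exact hχc.comp ((continuous_apply i).comp continuous_subtype_val)
  have hVd : Dense V := by
    refine Metric.dense_iff.2 fun x r hr ↦ ?_
    obtain ⟨b, hb, hg, hba⟩ := hB.exists_norm_sub_lt (fun i ↦ (x.2 i).1) hr
    obtain ⟨i, hi⟩ := exists_character_ne_zero (χ := χ) hg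
    refine ⟨⟨fun j ↦ x.1 j + algebraMap ℂ B (χ (b j - x.1 j)), fun j ↦ ⟨?_, ?_⟩⟩, ?_, i, ?_⟩
    · refine (x.2 j).1.add ?_
      rw [IsSelfAdjoint, ← algebraMap_star_comm, ← map_star, ((hb j).sub (x.2 j).1).star_eq]
    · have := (x.2 j).2
      rw [mem_idealAddScalars] at this ⊢
      rw [map_add, AlgHomClass.commutes]
      convert this using 1
      simp only [map_sub, map_add, Algebra.algebraMap_self, RingHom.id_apply]
      abel
    · rw [Metric.mem_ball, Subtype.dist_eq, dist_pi_lt_iff hr]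
      intro j
      rw [dist_eq_norm, add_sub_cancel_left]
      exact ((norm_algebraMap_le _).trans (norm_apply_le_of_character χ _)).trans_lt (hba j)
    · simpa [AlgHomClass.commutes] using hi
  have hd := (dense_iInter_of_isOpen hUo hUd).inter_of_isOpen_right hVd hVo
  obtain ⟨b, ⟨hbU, j, hj⟩, hba⟩ := hd.exists_dist_lt ⟨a, fun i ↦ ⟨ha i, haI i⟩⟩ hε
  refine ⟨b.1, b.2, hba, ?_⟩
  set C := (adjoin ℂ (Set.range b.1)).topologicalClosure with hC
  have hCc : IsClosed (C : Set B) := NonUnitalStarSubalgebra.isClosed_topologicalClosure _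
  have hSC : S ⊆ C := fun c hc ↦ by
    refine Metric.mem_closure_iff.2 fun δ hδ ↦ ?_
    obtain ⟨n, hn⟩ := exists_nat_one_div_lt hδ
    obtain ⟨z, hz, hzc⟩ := Set.mem_iInter.1 hbU (⟨c, hc⟩, n)
    refine ⟨z, hz, ?_⟩
    rw [dist_comm, dist_eq_norm]
    exact hzc.trans hn
  have hsaC : ∀ c ∈ I, IsSelfAdjoint c → c ∈ C := fun c hc hcsa ↦
    closure_minimal hSC hCc (hSd ⟨hc, hcsa⟩)
  have hIsmul : ∀ (r : ℝ), ∀ x ∈ I, r • x ∈ I := fun r x hx ↦ by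
    rw [← Complex.coe_smul]
    exact SMulMemClass.smul_mem _ hx
  have hIC : ∀ x ∈ I, x ∈ C := fun x hx ↦ by
    have h1 : (realPart x : B) ∈ I := by
      rw [realPart_apply_coe]
      exact hIsmul _ _ (add_mem hx (star_mem hx))
    have h2 : (imaginaryPart x : B) ∈ I := by
      rw [imaginaryPart_apply_coe]
      exact SMulMemClass.smul_mem _ (hIsmul _ _ (sub_mem hx (star_mem hx)))
    rw [← realPart_add_I_smul_imaginaryPart x]
    exact add_mem (hsaC _ h1 (realPart x).2)
      (SMulMemClass.smul_mem _ (hsaC _ h2 (imaginaryPart x).2))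
  have h1C : (1 : B) ∈ C := by
    have h1 : b.1 j ∈ C := subset_closure (subset_adjoin ℂ _ ⟨j, rfl⟩)
    have h2 := SMulMemClass.smul_mem (χ (b.1 j))⁻¹ (sub_mem h1 (hIC _ (b.2 j).2))
    rwa [sub_sub_cancel, Algebra.algebraMap_eq_smul_one, smul_smul, inv_mul_cancel₀ hj,
      one_smul] at h2
  intro d hd
  have h1 := add_mem (hIC _ hd) (SMulMemClass.smul_mem (χ d) h1C)
  rwa [← Algebra.algebraMap_eq_smul_one, sub_add_cancel] at h1

end IdealUnitization

section Unitization

variable {A : Type*} [NonUnitalCStarAlgebra A]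

/-- The canonical character of the unitization, as a `*`-homomorphism. -/
noncomputable def Unitization.fstStarAlgHom (A : Type*) [NonUnitalCStarAlgebra A] :
    Unitization ℂ A →⋆ₐ[ℂ] ℂ :=
  { Unitization.fstHom ℂ A with map_star' := fun _ ↦ rfl }

end Unitization

/-- Let `J` be a closed two-sided ideal in a C*-algebra `A`, regarded as a
C*-algebra in its own right. For every `k ≥ 1`, if `Gen_k(Ã)_sa` is dense in `Ã^k_sa`,
then `Gen_k(J̃)_sa` is dense in `J̃^k_sa`. In other words, `gr(J) ≤ gr(A)`. -/
theorem gr_ideal {A : Type*} [NonUnitalCStarAlgebra A]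
    (J : NonUnitalStarSubalgebra ℂ A) [IsClosed (J : Set A)]
    (hJ : ∀ a : A, ∀ x ∈ J, a * x ∈ J ∧ x * a ∈ J)
    {k : ℕ} (hk : 1 ≤ k)
    (h : ∀ a : Fin k → Unitization ℂ A, (∀ i, IsSelfAdjoint (a i)) →
      a ∈ closure {b : Fin k → Unitization ℂ A | (∀ i, IsSelfAdjoint (b i)) ∧ Generates b}) :
    ∀ a : Fin k → Unitization ℂ J, (∀ i, IsSelfAdjoint (a i)) →
      a ∈ closure {b : Fin k → Unitization ℂ J | (∀ i, IsSelfAdjoint (b i)) ∧ Generates b} := by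
  intro a ha
  let φ : Unitization ℂ J →⋆ₐ[ℂ] Unitization ℂ A :=
    Unitization.starMap (NonUnitalStarSubalgebraClass.subtype J)
  have hφinj : Function.Injective φ := Unitization.starMap_injective Subtype.val_injective
  have hφ : Isometry φ := NonUnitalStarAlgHom.isometry φ hφinj
  let I : NonUnitalStarSubalgebra ℂ (Unitization ℂ A) :=
    J.map (Unitization.inrNonUnitalStarAlgHom ℂ A)
  have hmemI : ∀ y, y ∈ I ↔ y.fst = 0 ∧ y.snd ∈ J := by
    intro y
    constructor
    · rintro ⟨x, hx, rfl⟩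
      exact ⟨rfl, hx⟩
    · rintro ⟨h1, h2⟩
      exact ⟨y.snd, h2, Unitization.ext h1.symm rfl⟩
  have hI : ∀ b : Unitization ℂ A, ∀ x ∈ I, b * x ∈ I ∧ x * b ∈ I := by
    intro b x hx
    rw [hmemI] at hx
    simp only [hmemI, Unitization.fst_mul, Unitization.snd_mul, hx.1, mul_zero, zero_mul,
      zero_smul, add_zero, zero_add, true_and]
    exact ⟨add_mem (SMulMemClass.smul_mem _ hx.2) (hJ _ _ hx.2).1,
      add_mem (SMulMemClass.smul_mem _ hx.2) (hJ _ _ hx.2).2⟩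
  have hIc : IsClosed (I : Set (Unitization ℂ A)) := by
    have : IsClosed (J : Set A) := inferInstance
    exact (Unitization.isometry_inr (𝕜 := ℂ) (A := A)).isClosedEmbedding.isClosedMap _ this
  let χ := Unitization.fstStarAlgHom A
  have hχ : ∀ x ∈ I, χ x = 0 := fun x hx ↦ ((hmemI x).1 hx).1
  have hrange : ∀ y, y ∈ idealAddScalars I hI χ ↔ ∃ x, φ x = y := by
    have hφ1 : ∀ x, φ x = Unitization.inl x.fst + Unitization.inr (x.snd : A) := fun x ↦ by
      induction x with
      | inl_add_inr r y => simp [φ, Unitization.algebraMap_eq_inl]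
    intro y
    have hsub : y - algebraMap ℂ (Unitization ℂ A) (χ y) = Unitization.inr y.snd :=
      sub_eq_of_eq_add' (Unitization.inl_fst_add_inr_snd_eq y).symm
    rw [mem_idealAddScalars, hsub, hmemI]
    simp only [Unitization.fst_inr, Unitization.snd_inr, true_and]
    constructor
    · intro hy
      refine ⟨Unitization.inl y.fst + Unitization.inr ⟨y.snd, hy⟩, ?_⟩
      rw [hφ1]
      ext <;> simp
    · rintro ⟨x, rfl⟩
      simp [hφ1]
  refine Metric.mem_closure_iff.2 fun ε hε ↦ ?_
  obtain ⟨b, hb, hab, hgen⟩ := DenseGenerators.exists_generating_idealAddScalars (hI := hI)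
    (χ := χ) h hIc hχ (a := fun i ↦ φ (a i)) (fun i ↦ (ha i).map φ)
    (fun i ↦ (hrange _).2 ⟨_, rfl⟩) hε
  choose b' hb' using fun i ↦ (hrange (b i)).1 (hb i).2
  obtain rfl : (fun i ↦ φ (b' i)) = b := funext hb'
  refine ⟨b', ⟨fun i ↦ hφinj ?_, ?_⟩, ?_⟩
  · rw [map_star]
    exact (hb i).1
  · rw [Generates, _root_.eq_top_iff]
    intro x _
    have h1 := hgen ((hrange _).2 ⟨x, rfl⟩)
    have h2 : (adjoin ℂ (Set.range fun i ↦ φ (b' i)) : Set (Unitization ℂ A)) =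
        φ '' (adjoin ℂ (Set.range b')) := by
      rw [show (Set.range fun i ↦ φ (b' i)) = φ '' Set.range b' from Set.range_comp φ b',
        ← NonUnitalStarAlgHom.map_adjoin]
      rfl
    change φ x ∈ closure (adjoin ℂ (Set.range fun i ↦ φ (b' i)) : Set (Unitization ℂ A)) at h1
    rw [h2] at h1
    change x ∈ closure (adjoin ℂ (Set.range b') : Set (Unitization ℂ J))
    rw [hφ.isEmbedding.isInducing.closure_eq_preimage_closure_image]
    exact h1
  · rw [dist_pi_lt_iff hε] at hab ⊢
    intro i
    rw [← hφ.dist_eq]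
    exact hab i
end

section
/- Let A and B be unital C*-algebras of real rank zero, i.e., in each of A and B the invertible self-adjoint elements are dense in the set of self-adjoint elements. Then for every k ≥ 1, Gen_k(A × B)_sa is dense in (A × B)^k_sa if and only if Gen_k(A)_sa is dense in A^k_sa and Gen_k(B)_sa is dense in B^k_sa. In other words, gr(A ⊕ B) = max{gr(A), gr(B)} for unital real rank zero C*-algebras. -/
open Topology Filter

/-- If the invertible self-adjoint elements are dense among the self-adjoint ones, then every
self-adjoint element is a limit of self-adjoint elements whose spectrum misses a given countable
set. -/
lemma mem_closure_isSelfAdjoint_disjoint_spectrum {A : Type*} [CStarAlgebra A]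
    (h : ∀ a : A, IsSelfAdjoint a → a ∈ closure {x : A | IsSelfAdjoint x ∧ IsUnit x})
    {D : Set ℝ} (hD : D.Countable) {a : A} (ha : IsSelfAdjoint a) :
    a ∈ closure {x : A | IsSelfAdjoint x ∧ Disjoint D (spectrum ℝ x)} := by
  have : Countable D := hD
  have hcl : IsClosed (selfAdjoint A : Set A) :=
    isClosed_eq continuous_star continuous_id
  have : CompleteSpace (selfAdjoint A) := hcl.completeSpace_coe
  have halg (t : ℝ) : IsSelfAdjoint (algebraMap ℝ A t) := .algebraMap A (.all t)
  let U (t : D) : Set (selfAdjoint A) := {x | IsUnit (algebraMap ℝ A t - (x : A))}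
  have hU : Dense (⋂ t, U t) := by
    refine dense_iInter_of_isOpen
      (fun t ↦ Units.isOpen.preimage (continuous_const.sub continuous_subtype_val)) fun t x ↦ ?_
    rw [Metric.mem_closure_iff]
    intro ε hε
    obtain ⟨y, ⟨hy, hyu⟩, hyx⟩ :=
      Metric.mem_closure_iff.1 (h _ ((halg t).sub x.2)) ε hε
    refine ⟨⟨algebraMap ℝ A t - y, (halg t).sub hy⟩, by simpa [U] using hyu, ?_⟩
    rw [Subtype.dist_eq, dist_eq_norm] at *
    rw [← norm_neg]
    convert! hyx using 2
    simp only
    abel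
  rw [Metric.mem_closure_iff]
  intro ε hε
  obtain ⟨y, hy, hay⟩ := Metric.mem_closure_iff.1 (hU ⟨a, ha⟩) ε hε
  refine ⟨y, ⟨y.2, Set.disjoint_left.2 fun t ht hty ↦ ?_⟩, hay⟩
  exact hty (Set.mem_iInter.1 hy ⟨t, ht⟩)

/-- Every self-adjoint element of a real rank zero C*-algebra is a limit of self-adjoint elements
whose spectrum lies in an arithmetic progression `ε * (ℤ + θ)`. -/
lemma exists_isSelfAdjoint_fract_spectrum {A : Type*} [CStarAlgebra A]
    (h : ∀ a : A, IsSelfAdjoint a → a ∈ closure {x : A | IsSelfAdjoint x ∧ IsUnit x})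
    {a : A} (ha : IsSelfAdjoint a) {ε θ : ℝ} (hε : 0 < ε) (hθ : θ ∈ Set.Ioo (0 : ℝ) 1) :
    ∃ x : A, IsSelfAdjoint x ∧ dist a x < 2 * ε ∧
      ∀ t ∈ spectrum ℝ x, Int.fract (t / ε) = θ := by
  obtain ⟨y, ⟨hy, hyD⟩, hay⟩ := Metric.mem_closure_iff.1
    (mem_closure_isSelfAdjoint_disjoint_spectrum h
      (Set.countable_range fun n : ℤ ↦ ε * n) ha) ε hε
  let f : ℝ → ℝ := fun t ↦ ε * (⌊t / ε⌋ + θ)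
  have hf : ContinuousOn f (spectrum ℝ y) := by
    intro t ht
    have hfl : ContinuousAt (fun s : ℝ ↦ (⌊s / ε⌋ : ℝ)) t := by
      have hlt : (⌊t / ε⌋ : ℝ) < t / ε := by
        refine (Int.floor_le _).lt_of_ne fun heq ↦ Set.disjoint_left.1 hyD ⟨⌊t / ε⌋, ?_⟩ ht
        simp only
        rw [heq]
        field_simp
      have hev : ∀ᶠ s in 𝓝 t, s / ε ∈ Set.Ioo (⌊t / ε⌋ : ℝ) (⌊t / ε⌋ + 1) :=
        (continuous_id.div_const ε).continuousAt.eventually_mem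
          (isOpen_Ioo.mem_nhds ⟨hlt, Int.lt_floor_add_one _⟩)
      refine (continuousAt_const (y := (⌊t / ε⌋ : ℝ))).congr ?_
      filter_upwards [hev] with s hs
      rw [Int.floor_eq_iff.2 ⟨hs.1.le, hs.2⟩]
    exact (continuousAt_const.mul (hfl.add continuousAt_const)).continuousWithinAt
  refine ⟨cfc f y, cfc_predicate f y, ?_, ?_⟩
  · have hle : dist y (cfc f y) ≤ ε := by
      rw [dist_eq_norm]
      nth_rewrite 1 [← cfc_id ℝ y hy]
      rw [← cfc_sub id f y]
      refine norm_cfc_le hε.le fun t _ ↦ ?_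
      have h1 := Int.floor_le (t / ε)
      have h2 := Int.lt_floor_add_one (t / ε)
      have h3 : id t - f t = ε * (t / ε - ⌊t / ε⌋ - θ) := by
        simp only [id, f]
        field_simp
        ring
      rw [h3, Real.norm_eq_abs, abs_mul, abs_of_pos hε]
      refine mul_le_of_le_one_right hε.le (abs_le.2 ⟨?_, ?_⟩) <;> linarith [hθ.1, hθ.2]
    linarith [dist_triangle a y (cfc f y)]
  · rw [cfc_map_spectrum f y]
    rintro _ ⟨t, -, rfl⟩
    simp only [f]
    rw [mul_div_cancel_left₀ _ hε.ne', Int.fract_intCast_add, Int.fract_eq_self]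
    exact ⟨hθ.1.le, hθ.2⟩

/-- A closed `*`-subalgebra of `A × B` containing a self-adjoint pair of invertible elements with
disjoint spectra contains `(1, 0)`. -/
lemma one_zero_mem_of_disjoint_spectrum {A B : Type*} [CStarAlgebra A] [CStarAlgebra B]
    {S : NonUnitalStarSubalgebra ℂ (A × B)} (hS : IsClosed (S : Set (A × B)))
    {a : A} {b : B} (ha : IsSelfAdjoint a) (hb : IsSelfAdjoint b)
    (h0 : (0 : ℝ) ∉ spectrum ℝ a) (hab : Disjoint (spectrum ℝ a) (spectrum ℝ b))
    (hmem : (a, b) ∈ S) : ((1, 0) : A × B) ∈ S := by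
  obtain ⟨f, hf0, hf1, -⟩ := exists_continuous_zero_one_of_isClosed
    (s := spectrum ℝ b ∪ {0}) (t := spectrum ℝ a)
    ((spectrum.isClosed b).union isClosed_singleton) (spectrum.isClosed a)
    (Set.disjoint_union_left.2 ⟨hab.symm, Set.disjoint_singleton_left.2 h0⟩)
  have hab' : IsSelfAdjoint ((a, b) : A × B) := Prod.ext ha hb
  have hfz : f 0 = 0 := hf0 (Or.inr rfl)
  have key : cfcₙ f ((a, b) : A × B) = (1, 0) := by
    refine Prod.ext ?_ ?_
    · refine ((NonUnitalStarAlgHom.fst ℂ A B).map_cfcₙ f (a, b) f.continuous.continuousOn hfz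
        continuous_fst hab' ha).trans ?_
      simp only [NonUnitalStarAlgHom.fst_apply]
      rw [cfcₙ_eq_cfc (hf := f.continuous.continuousOn) (hf0 := hfz),
        cfc_congr (g := fun _ ↦ 1) hf1, cfc_const_one ℝ a ha]
    · refine ((NonUnitalStarAlgHom.snd ℂ A B).map_cfcₙ f (a, b) f.continuous.continuousOn hfz
        continuous_snd hab' hb).trans ?_
      simp only [NonUnitalStarAlgHom.snd_apply]
      rw [cfcₙ_eq_cfc (hf := f.continuous.continuousOn) (hf0 := hfz),
        cfc_congr (g := fun _ ↦ 0) (hf0.mono Set.subset_union_left), cfc_const_zero ℝ b]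
  rw [← key]
  have : IsClosed (S : Set (A × B)) := hS
  exact cfcₙ_mem f hmem

lemma NonUnitalStarSubalgebra.eq_top_of_map_fst_snd {A B : Type*}
    [CStarAlgebra A] [CStarAlgebra B] (S : NonUnitalStarSubalgebra ℂ (A × B))
    (hA : (S.map (NonUnitalStarAlgHom.fst ℂ A B)).topologicalClosure = ⊤)
    (hB : (S.map (NonUnitalStarAlgHom.snd ℂ A B)).topologicalClosure = ⊤)
    (h10 : ((1, 0) : A × B) ∈ S.topologicalClosure) : S.topologicalClosure = ⊤ := by
  have hcl : IsClosed (S.topologicalClosure : Set (A × B)) := S.isClosed_topologicalClosure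
  have h1 (x : A) : ((x, 0) : A × B) ∈ S.topologicalClosure := by
    have hx : x ∈ (S.map (NonUnitalStarAlgHom.fst ℂ A B)).topologicalClosure := hA ▸ trivial
    have hsub : ((S.map (NonUnitalStarAlgHom.fst ℂ A B) : NonUnitalStarSubalgebra ℂ A) : Set A) ⊆
        (fun x ↦ ((x, 0) : A × B)) ⁻¹' S.topologicalClosure := by
      rintro _ ⟨s, hs, rfl⟩
      have hmul := mul_mem h10 (S.le_topologicalClosure hs)
      rwa [Prod.mul_def, one_mul, zero_mul] at hmul
    exact closure_minimal hsub (hcl.preimage (by fun_prop)) hx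
  have h2 (y : B) : ((0, y) : A × B) ∈ S.topologicalClosure := by
    have hy : y ∈ (S.map (NonUnitalStarAlgHom.snd ℂ A B)).topologicalClosure := hB ▸ trivial
    have hsub : ((S.map (NonUnitalStarAlgHom.snd ℂ A B) : NonUnitalStarSubalgebra ℂ B) : Set B) ⊆
        (fun y ↦ ((0, y) : A × B)) ⁻¹' S.topologicalClosure := by
      rintro _ ⟨s, hs, rfl⟩
      have hsub := sub_mem (S.le_topologicalClosure hs) (h1 s.1)
      rwa [Prod.sub_def, sub_self, sub_zero] at hsub
    exact closure_minimal hsub (hcl.preimage (by fun_prop)) hy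
  refine eq_top_iff.2 fun p _ ↦ ?_
  simpa using add_mem (h1 p.1) (h2 p.2)

/-- The image of a generating tuple under a continuous surjective `*`-homomorphism is
generating. -/
lemma Generates.map {A B : Type*} [NonUnitalCStarAlgebra A] [NonUnitalCStarAlgebra B]
    {k : ℕ} {c : Fin k → A} (hc : Generates c) (φ : A →⋆ₙₐ[ℂ] B) (hφ : Continuous φ)
    (hsurj : Function.Surjective φ) : Generates fun i ↦ φ (c i) := by
  have hr : Set.range (fun i ↦ φ (c i)) = φ '' Set.range c := Set.range_comp φ c
  rw [Generates, hr, ← NonUnitalStarAlgHom.map_adjoin]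
  refine top_le_iff.1 (le_trans ?_
    (NonUnitalStarSubalgebra.map_topologicalClosure_le (R := ℂ) _ hφ))
  rw [hc]
  rintro y -
  obtain ⟨x, rfl⟩ := hsurj y
  exact ⟨x, trivial, rfl⟩

/-- Tuples generating `A` and `B`, whose entries at some index are invertible with disjoint
spectra, together generate `A × B`. -/
lemma Generates.prodMk {A B : Type*} [CStarAlgebra A] [CStarAlgebra B] {k : ℕ}
    {a : Fin k → A} {b : Fin k → B} (hga : Generates a) (hgb : Generates b) (i : Fin k)
    (ha : IsSelfAdjoint (a i)) (hb : IsSelfAdjoint (b i)) (h0 : (0 : ℝ) ∉ spectrum ℝ (a i))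
    (hab : Disjoint (spectrum ℝ (a i)) (spectrum ℝ (b i))) :
    Generates fun j ↦ (a j, b j) := by
  refine NonUnitalStarSubalgebra.eq_top_of_map_fst_snd _ ?_ ?_ ?_
  · rw [NonUnitalStarAlgHom.map_adjoin, ← Set.range_comp]
    exact hga
  · rw [NonUnitalStarAlgHom.map_adjoin, ← Set.range_comp]
    exact hgb
  · refine one_zero_mem_of_disjoint_spectrum
      (NonUnitalStarSubalgebra.isClosed_topologicalClosure _) ha hb h0 hab ?_
    exact NonUnitalStarSubalgebra.le_topologicalClosure _
      (NonUnitalStarAlgebra.subset_adjoin ℂ _ ⟨i, rfl⟩)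

/-- For unital C*-algebras `A`, `B` of real rank zero and `k ≥ 1`,
`Gen_k(A × B)_sa` is dense in `(A × B)^k_sa` iff `Gen_k(A)_sa` is dense in `A^k_sa` and
`Gen_k(B)_sa` is dense in `B^k_sa`. In other words `gr(A ⊕ B) = max {gr A, gr B}`. -/
theorem gr_sum_rr0 {A B : Type*} [CStarAlgebra A] [CStarAlgebra B]
    (hrrA : ∀ a : A, IsSelfAdjoint a → a ∈ closure {x : A | IsSelfAdjoint x ∧ IsUnit x})
    (hrrB : ∀ b : B, IsSelfAdjoint b → b ∈ closure {x : B | IsSelfAdjoint x ∧ IsUnit x})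
    {k : ℕ} (hk : 1 ≤ k) :
    (∀ a : Fin k → A × B, (∀ i, IsSelfAdjoint (a i)) →
      a ∈ closure {b : Fin k → A × B | (∀ i, IsSelfAdjoint (b i)) ∧ Generates b}) ↔
    ((∀ a : Fin k → A, (∀ i, IsSelfAdjoint (a i)) →
      a ∈ closure {b : Fin k → A | (∀ i, IsSelfAdjoint (b i)) ∧ Generates b}) ∧
     (∀ a : Fin k → B, (∀ i, IsSelfAdjoint (a i)) →
      a ∈ closure {b : Fin k → B | (∀ i, IsSelfAdjoint (b i)) ∧ Generates b})) := by
  constructor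
  · refine fun h ↦ ⟨fun a ha ↦ ?_, fun b hb ↦ ?_⟩
    · refine map_mem_closure (f := fun c : Fin k → A × B ↦ fun i ↦ (c i).1) (by fun_prop)
        (h (fun i ↦ (a i, 0)) fun i ↦ Prod.ext (ha i) (star_zero B)) fun c hc ↦ ⟨fun i ↦ ?_, ?_⟩
      · exact congrArg Prod.fst (hc.1 i)
      · exact hc.2.map (NonUnitalStarAlgHom.fst ℂ A B) continuous_fst Prod.fst_surjective
    · refine map_mem_closure (f := fun c : Fin k → A × B ↦ fun i ↦ (c i).2) (by fun_prop)
        (h (fun i ↦ (0, b i)) fun i ↦ Prod.ext (star_zero A) (hb i)) fun c hc ↦ ⟨fun i ↦ ?_, ?_⟩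
      · exact congrArg Prod.snd (hc.1 i)
      · exact hc.2.map (NonUnitalStarAlgHom.snd ℂ A B) continuous_snd Prod.snd_surjective
  · rintro ⟨hA, hB⟩ c hc
    rw [Metric.mem_closure_iff]
    intro ε hε
    let i₀ : Fin k := ⟨0, hk⟩
    have hc1 (i) : IsSelfAdjoint (c i).1 := congrArg Prod.fst (hc i)
    have hc2 (i) : IsSelfAdjoint (c i).2 := congrArg Prod.snd (hc i)
    have hδ : 0 < ε / 4 := by positivity
    obtain ⟨x, hx, hcx, hxs⟩ := exists_isSelfAdjoint_fract_spectrum hrrA (hc1 i₀) hδ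
      (θ := 1 / 3) (by norm_num)
    obtain ⟨y, hy, hcy, hys⟩ := exists_isSelfAdjoint_fract_spectrum hrrB (hc2 i₀) hδ
      (θ := 2 / 3) (by norm_num)
    obtain ⟨V, W, hV, hW, hxV, hyW, hVW⟩ : SeparatedNhds (spectrum ℝ x) (spectrum ℝ y) := by
      refine .of_isCompact_isCompact (spectrum.isCompact x) (spectrum.isCompact y)
        (Set.disjoint_left.2 fun t htx hty ↦ ?_)
      have := (hxs t htx).symm.trans (hys t hty)
      norm_num at this
    have hx0 : (0 : ℝ) ∉ spectrum ℝ x := fun h0 ↦ by simpa using hxs 0 h0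
    let a' : Fin k → A := Function.update (fun i ↦ (c i).1) i₀ x
    let b' : Fin k → B := Function.update (fun i ↦ (c i).2) i₀ y
    have ha' (i) : IsSelfAdjoint (a' i) := by
      rcases eq_or_ne i i₀ with rfl | hi <;> simp [a', *]
    have hb' (i) : IsSelfAdjoint (b' i) := by
      rcases eq_or_ne i i₀ with rfl | hi <;> simp [b', *]
    have hda (i) : dist (c i).1 (a' i) < ε := by
      rcases eq_or_ne i i₀ with rfl | hi
      · simp only [a', Function.update_self]; linarith
      · simpa [a', hi] using hε
    have hdb (i) : dist (c i).2 (b' i) < ε := by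
      rcases eq_or_ne i i₀ with rfl | hi
      · simp only [b', Function.update_self]; linarith
      · simpa [b', hi] using hε
    have hevA : ∀ᶠ u in 𝓝 a', (∀ i, dist (c i).1 (u i) < ε) ∧
        spectrum ℝ (u i₀) ⊆ V ∩ {0}ᶜ := by
      refine (eventually_all.2 fun i ↦ ?_).and ?_
      · exact (continuous_const.dist (continuous_apply i)).continuousAt.eventually_lt_const (hda i)
      · have hcont : Tendsto (fun u : Fin k → A ↦ u i₀) (𝓝 a') (𝓝 x) := by
          simpa [a'] using (continuous_apply i₀).tendsto a'
        exact hcont.eventually (upperHemicontinuous_iff_forall_isOpen.1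
          (upperHemicontinuous_spectrum ℝ A) x _ (hV.inter isOpen_compl_singleton)
          (Set.subset_inter hxV (Set.subset_compl_singleton_iff.2 hx0)))
    have hevB : ∀ᶠ u in 𝓝 b', (∀ i, dist (c i).2 (u i) < ε) ∧ spectrum ℝ (u i₀) ⊆ W := by
      refine (eventually_all.2 fun i ↦ ?_).and ?_
      · exact (continuous_const.dist (continuous_apply i)).continuousAt.eventually_lt_const (hdb i)
      · have hcont : Tendsto (fun u : Fin k → B ↦ u i₀) (𝓝 b') (𝓝 y) := by
          simpa [b'] using (continuous_apply i₀).tendsto b'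
        exact hcont.eventually (upperHemicontinuous_iff_forall_isOpen.1
          (upperHemicontinuous_spectrum ℝ B) y _ hW hyW)
    obtain ⟨u, ⟨hu, hug⟩, hud, hus⟩ :=
      ((mem_closure_iff_frequently.1 (hA a' ha')).and_eventually hevA).exists
    obtain ⟨v, ⟨hv, hvg⟩, hvd, hvs⟩ :=
      ((mem_closure_iff_frequently.1 (hB b' hb')).and_eventually hevB).exists
    refine ⟨fun i ↦ (u i, v i), ⟨fun i ↦ Prod.ext (hu i) (hv i), ?_⟩, ?_⟩
    · exact hug.prodMk hvg i₀ (hu i₀) (hv i₀) (fun h0 ↦ (hus h0).2 rfl)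
        (hVW.mono (hus.trans Set.inter_subset_left) hvs)
    · exact (dist_pi_lt_iff hε).2 fun i ↦ max_lt (hud i) (hvd i)
end

section
/- Let A be a separable AF-algebra, i.e., a separable C*-algebra such that for every finite subset F ⊆ A and every ε > 0 there is a finite-dimensional closed *-subalgebra B ⊆ A with every element of F within distance ε of B. Then gr(A) ≤ 1; that is, Gen_2(Ã)_sa is dense in Ã²_sa, where à is the minimal unitization of A. In particular, A contains a dense set of generators. -/
open Filter Topology

/-- A finite product of full matrix algebras is generated, as a non-unital algebra, by a diagonal
element with distinct nonzero entries together with the element all of whose entries are `1`. -/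
lemma exists_pair_adjoin_pi_matrix_eq_top {n : ℕ} (d : Fin n → ℕ) :
    ∃ g : Fin 2 → (Π i, Matrix (Fin (d i)) (Fin (d i)) ℂ),
      NonUnitalAlgebra.adjoin ℂ (Set.range g) = ⊤ := by
  classical
  let ι := Σ i, Fin (d i)
  let l : ι → ℂ := fun p ↦ ((Fintype.equivFin ι p : ℕ) : ℂ) + 1
  have hl : Function.Injective l := fun p q h ↦ by
    simpa [l, Fin.val_inj] using h
  have hl0 : ∀ p, l p ≠ 0 := fun p ↦ Nat.cast_add_one_ne_zero _
  let D : (ι → ℂ) → (Π i, Matrix (Fin (d i)) (Fin (d i)) ℂ) :=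
    fun r i ↦ Matrix.diagonal fun j ↦ r ⟨i, j⟩
  let J : Π i, Matrix (Fin (d i)) (Fin (d i)) ℂ := fun i ↦ Matrix.of fun _ _ ↦ 1
  refine ⟨![D l, J], ?_⟩
  set N := NonUnitalAlgebra.adjoin ℂ (Set.range ![D l, J])
  have hD : D l ∈ N := NonUnitalAlgebra.subset_adjoin ℂ ⟨0, rfl⟩
  have hJ : J ∈ N := NonUnitalAlgebra.subset_adjoin ℂ ⟨1, rfl⟩
  have hpoly : ∀ q : Polynomial ℂ, D (fun p ↦ l p * q.eval (l p)) ∈ N := by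
    intro q
    induction q using Polynomial.induction_on with
    | C c =>
      convert! N.smul_mem c hD using 1
      ext i j k
      simp [D, Matrix.diagonal_apply, mul_comm]
    | add p q hp hq =>
      convert! N.add_mem hp hq using 1
      ext i j k
      by_cases h : j = k <;> simp [D, mul_add, h]
    | monomial n c h =>
      convert! N.mul_mem h hD using 1
      ext i j k
      by_cases h : j = k <;> simp [D, h]
      ring
  have hdiag : ∀ r, D r ∈ N := by
    intro r
    have hr : r = fun p ↦
        l p * (Lagrange.interpolate Finset.univ l fun p ↦ r p / l p).eval (l p) := by
      funext p
      rw [Lagrange.eval_interpolate_at_node _ hl.injOn (Finset.mem_univ p),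
        mul_div_cancel₀ _ (hl0 p)]
    rw [hr]
    exact hpoly _
  let E : ι → (Π i, Matrix (Fin (d i)) (Fin (d i)) ℂ) := fun p ↦ D fun q ↦ if q = p then 1 else 0
  refine eq_top_iff.2 fun x _ ↦ ?_
  let c : ι → ι → ℂ := fun p q ↦ if h : q.1 = p.1 then x p.1 p.2 (h ▸ q.2) else 0
  have hx : x = ∑ p, ∑ q, c p q • (E p * J * E q) := by
    ext i j k
    have h : ∀ p q : ι, (c p q • (E p * J * E q)) i j k =
        if (⟨i, k⟩ : ι) = q then if (⟨i, j⟩ : ι) = p then c p q else 0 else 0 := by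
      intro p q
      by_cases h1 : (⟨i, k⟩ : ι) = q <;> by_cases h2 : (⟨i, j⟩ : ι) = p <;>
        simp [E, D, J, h1, h2]
    simp only [Finset.sum_apply, Matrix.sum_apply, h]
    rw [Finset.sum_comm, Finset.sum_eq_single ⟨i, k⟩ (fun q _ hq ↦ by simp [hq.symm]) (by simp),
      Finset.sum_eq_single ⟨i, j⟩ (fun p _ hp ↦ by simp [hp.symm]) (by simp)]
    simp [c]
  have hE : ∀ p, E p ∈ N := fun p ↦ hdiag fun q ↦ if q = p then 1 else 0
  rw [hx]
  exact sum_mem fun p _ ↦ sum_mem fun q _ ↦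
    N.smul_mem _ (N.mul_mem (N.mul_mem (hE p) hJ) (hE q))

lemma isSemisimpleRing_of_finiteDimensional_cstarRing (S : Type*) [NormedRing S] [StarRing S]
    [CStarRing S] [NormedAlgebra ℂ S] [FiniteDimensional ℂ S] : IsSemisimpleRing S := by
  have : IsArtinianRing S := IsArtinianRing.of_finite ℂ S
  rw [IsArtinianRing.isSemisimpleRing_iff_jacobson, eq_bot_iff]
  intro x hx
  obtain ⟨n, hn⟩ := IsSemiprimaryRing.isNilpotent (R := S)
  have hmem : (star x * x) ^ n ∈ Ring.jacobson S ^ n :=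
    Ideal.pow_mem_pow (Ideal.mul_mem_left _ _ hx) n
  have h0 : (star x * x) ^ n = 0 := by simpa [hn] using hmem
  have h1 : (star x * x) ^ 2 ^ n = 0 := pow_eq_zero_of_le n.lt_two_pow_self.le h0
  have h2 := (IsSelfAdjoint.star_mul_self x).norm_pow_two_pow n
  rw [h1, norm_zero] at h2
  have h3 : star x * x = 0 := norm_eq_zero.1 (pow_eq_zero_iff (by positivity) |>.1 h2.symm)
  simpa using (CStarRing.star_mul_self_eq_zero_iff x).1 h3

lemma exists_pair_adjoin_eq_top (S : Type*) [NormedRing S] [StarRing S]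
    [CStarRing S] [NormedAlgebra ℂ S] [FiniteDimensional ℂ S] :
    ∃ g : Fin 2 → S, NonUnitalAlgebra.adjoin ℂ (Set.range g) = ⊤ := by
  have := isSemisimpleRing_of_finiteDimensional_cstarRing S
  obtain ⟨n, d, _, ⟨e⟩⟩ := IsSemisimpleRing.exists_algEquiv_pi_matrix_of_isAlgClosed ℂ S
  obtain ⟨g, hg⟩ := exists_pair_adjoin_pi_matrix_eq_top d
  refine ⟨fun i ↦ e.symm (g i), eq_top_iff.2 fun x _ ↦ ?_⟩
  have h : NonUnitalAlgebra.adjoin ℂ (Set.range g) ≤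
      (NonUnitalAlgebra.adjoin ℂ (Set.range fun i ↦ e.symm (g i))).comap
        (e.symm : _ →ₐ[ℂ] S) := by
    refine NonUnitalAlgebra.adjoin_le ?_
    rintro _ ⟨i, rfl⟩
    exact NonUnitalAlgebra.subset_adjoin ℂ ⟨i, rfl⟩
  have hx : e x ∈ NonUnitalAlgebra.adjoin ℂ (Set.range g) := hg ▸ trivial
  simpa using h hx

/-- Generation of a finite-dimensional algebra persists generically along complex lines: if
`x + z₀ • v` generates `S`, then so does `x + t • v` for arbitrarily small real `t`. -/
lemma exists_small_real_adjoin_eq_top {S : Type*} [NormedRing S] [NormedAlgebra ℂ S]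
    [FiniteDimensional ℂ S] {x v : Fin 2 → S} {z₀ : ℂ}
    (h : NonUnitalAlgebra.adjoin ℂ (Set.range (x + z₀ • v)) = ⊤) {ε : ℝ} (hε : 0 < ε) :
    ∃ t : ℝ, |t| < ε ∧ NonUnitalAlgebra.adjoin ℂ (Set.range (x + (t : ℂ) • v)) = ⊤ := by
  classical
  have hlift : ∀ y : S, ∃ f : ℂ → S, Differentiable ℂ f ∧ f z₀ = y ∧
      ∀ z, f z ∈ NonUnitalAlgebra.adjoin ℂ (Set.range (x + z • v)) := by
    intro y
    have hy : y ∈ NonUnitalAlgebra.adjoin ℂ (Set.range (x + z₀ • v)) := h ▸ trivial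
    induction hy using NonUnitalAlgebra.adjoin_induction with
    | mem y hy =>
      obtain ⟨i, rfl⟩ := hy
      exact ⟨fun z ↦ x i + z • v i, by fun_prop, rfl,
        fun z ↦ NonUnitalAlgebra.subset_adjoin ℂ ⟨i, rfl⟩⟩
    | add a b _ _ ha hb =>
      obtain ⟨f, hf, rfl, hfm⟩ := ha
      obtain ⟨g, hg, rfl, hgm⟩ := hb
      exact ⟨fun z ↦ f z + g z, by fun_prop, rfl, fun z ↦ add_mem (hfm z) (hgm z)⟩
    | zero => exact ⟨fun _ ↦ 0, by fun_prop, rfl, fun z ↦ zero_mem _⟩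
    | mul a b _ _ ha hb =>
      obtain ⟨f, hf, rfl, hfm⟩ := ha
      obtain ⟨g, hg, rfl, hgm⟩ := hb
      exact ⟨fun z ↦ f z * g z, hf.mul hg, rfl, fun z ↦ mul_mem (hfm z) (hgm z)⟩
    | smul r a _ ha =>
      obtain ⟨f, hf, rfl, hfm⟩ := ha
      exact ⟨fun z ↦ r • f z, by fun_prop, rfl, fun z ↦ SMulMemClass.smul_mem r (hfm z)⟩
  let b := Module.finBasis ℂ S
  choose f hf hf₀ hfm using fun j ↦ hlift (b j)
  let p : ℂ → ℂ := fun z ↦ b.det fun j ↦ f j z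
  have hp : Differentiable ℂ p := by
    have hcoord : ∀ i j, Differentiable ℂ fun z ↦ b.repr (f j z) i := fun i j ↦
      (LinearMap.toContinuousLinearMap (b.coord i)).differentiable.comp (hf j)
    simp only [p, Module.Basis.det_apply, Matrix.det_apply, Module.Basis.toMatrix_apply]
    fun_prop
  have hp₀ : p z₀ = 1 := by simp [p, hf₀, b.det_self]
  obtain ⟨t, ht, hpt⟩ : ∃ t : ℝ, |t| < ε ∧ p t ≠ 0 := by
    by_contra! hcon
    have hfreq : ∃ᶠ z in 𝓝[≠] (0 : ℂ), p z = 0 := by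
      have htend : Tendsto (fun t : ℝ ↦ (t : ℂ)) (𝓝[≠] 0) (𝓝[≠] (0 : ℂ)) := by
        refine tendsto_nhdsWithin_iff.2 ⟨?_, ?_⟩
        · exact (Complex.continuous_ofReal.tendsto' 0 0 (by simp)).mono_left nhdsWithin_le_nhds
        · filter_upwards [self_mem_nhdsWithin] with t ht
          simpa using ht
      refine htend.frequently (Eventually.frequently ?_)
      filter_upwards [nhdsWithin_le_nhds (Metric.ball_mem_nhds (0 : ℝ) hε)] with t ht
      exact hcon t (by simpa using ht)
    have := (hp.differentiableOn.analyticOnNhd isOpen_univ).eqOn_zero_of_preconnected_of_frequently_eq_zero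
      isPreconnected_univ (Set.mem_univ _) hfreq (Set.mem_univ z₀)
    simp [hp₀] at this
  refine ⟨t, ht, eq_top_iff.2 fun y _ ↦ ?_⟩
  have hspan := (b.is_basis_iff_det.2 (isUnit_iff_ne_zero.2 hpt)).2
  have hle : Submodule.span ℂ (Set.range fun j ↦ f j t) ≤
      (NonUnitalAlgebra.adjoin ℂ (Set.range (x + (t : ℂ) • v))).toSubmodule := by
    rw [Submodule.span_le]
    rintro _ ⟨j, rfl⟩
    exact hfm j t
  exact hle (hspan ▸ trivial)

/-- In a finite-dimensional C*-algebra, pairs of self-adjoint generators are dense. -/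
lemma exists_selfAdjoint_pair_adjoin_eq_top {S : Type*} [NormedRing S] [StarRing S]
    [CStarRing S] [NormedAlgebra ℂ S] [StarModule ℂ S] [FiniteDimensional ℂ S]
    {a : Fin 2 → S} (ha : ∀ i, IsSelfAdjoint (a i)) {ε : ℝ} (hε : 0 < ε) :
    ∃ b : Fin 2 → S, (∀ i, IsSelfAdjoint (b i)) ∧ ‖a - b‖ < ε ∧
      NonUnitalAlgebra.adjoin ℂ (Set.range b) = ⊤ := by
  obtain ⟨g, hg⟩ := exists_pair_adjoin_eq_top S
  let h : Fin 2 → S := fun i ↦ realPart (g i)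
  let k : Fin 2 → S := fun i ↦ imaginaryPart (g i)
  have hk : ∀ i, IsSelfAdjoint (k i) := fun i ↦ (imaginaryPart (g i)).2
  have hh : ∀ i, IsSelfAdjoint (h i) := fun i ↦ (realPart (g i)).2
  have hreal : ∀ (t : ℝ) {y : S}, IsSelfAdjoint y → IsSelfAdjoint ((t : ℂ) • y) := fun t y hy ↦
    IsSelfAdjoint.smul (Complex.conj_ofReal t) hy
  have hgk : g = h + Complex.I • k := funext fun i ↦ (realPart_add_I_smul_imaginaryPart (g i)).symm
  rw [hgk] at hg
  obtain ⟨s, -, hs⟩ := exists_small_real_adjoin_eq_top hg one_pos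
  let w := h + (s : ℂ) • k - a
  have hw : ∀ i, IsSelfAdjoint (w i) := fun i ↦ ((hh i).add (hreal s (hk i))).sub (ha i)
  have hw₁ : a + (1 : ℂ) • w = h + (s : ℂ) • k := by simp [w]
  rw [← hw₁] at hs
  obtain ⟨t, ht, hgen⟩ := exists_small_real_adjoin_eq_top hs
    (show 0 < ε / (‖w‖ + 1) by positivity)
  refine ⟨a + (t : ℂ) • w, fun i ↦ (ha i).add (hreal t (hw i)), ?_, hgen⟩
  rw [sub_add_cancel_left, norm_neg, norm_smul, Complex.norm_real, Real.norm_eq_abs]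
  rw [lt_div_iff₀ (by positivity)] at ht
  nlinarith [abs_nonneg t]

/-- The tuples whose generated `*`-subalgebra meets a given open set form an open set. -/
lemma isOpen_setOf_exists_mem_starAdjoin {B : Type*} [NonUnitalCStarAlgebra B] {k : ℕ}
    {V : Set B} (hV : IsOpen V) :
    IsOpen {b : Fin k → B | ∃ p ∈ NonUnitalStarAlgebra.adjoin ℂ (Set.range b), p ∈ V} := by
  rw [isOpen_iff_mem_nhds]
  rintro b ⟨p, hp, hpV⟩
  obtain ⟨f, hf, rfl, hfm⟩ : ∃ f : (Fin k → B) → B, Continuous f ∧ f b = p ∧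
      ∀ b', f b' ∈ NonUnitalStarAlgebra.adjoin ℂ (Set.range b') := by
    clear hpV
    induction hp using NonUnitalStarAlgebra.adjoin_induction with
    | mem y hy =>
      obtain ⟨i, rfl⟩ := hy
      exact ⟨fun b' ↦ b' i, by fun_prop, rfl,
        fun b' ↦ NonUnitalStarAlgebra.subset_adjoin ℂ _ ⟨i, rfl⟩⟩
    | add x y _ _ hx hy =>
      obtain ⟨f, hf, rfl, hfm⟩ := hx
      obtain ⟨g, hg, rfl, hgm⟩ := hy
      exact ⟨fun z ↦ f z + g z, by fun_prop, rfl, fun z ↦ add_mem (hfm z) (hgm z)⟩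
    | zero => exact ⟨fun _ ↦ 0, by fun_prop, rfl, fun z ↦ zero_mem _⟩
    | mul x y _ _ hx hy =>
      obtain ⟨f, hf, rfl, hfm⟩ := hx
      obtain ⟨g, hg, rfl, hgm⟩ := hy
      exact ⟨fun z ↦ f z * g z, by fun_prop, rfl, fun z ↦ mul_mem (hfm z) (hgm z)⟩
    | smul r x _ hx =>
      obtain ⟨f, hf, rfl, hfm⟩ := hx
      exact ⟨fun z ↦ r • f z, by fun_prop, rfl, fun z ↦ SMulMemClass.smul_mem r (hfm z)⟩
    | star x _ hx =>
      obtain ⟨f, hf, rfl, hfm⟩ := hx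
      exact ⟨fun z ↦ star (f z), by fun_prop, rfl, fun z ↦ star_mem (hfm z)⟩
  filter_upwards [hf.continuousAt.preimage_mem_nhds (hV.mem_nhds hpV)] with b' hb'
  exact ⟨f b', hfm b', hb'⟩

/-- If finite-dimensional unital `*`-subalgebras of `B` approximate all finite subsets, then the
self-adjoint pairs whose generated `*`-subalgebra comes close to a given element are dense among
the self-adjoint pairs. -/
lemma exists_selfAdjoint_pair_near {B : Type*} [CStarAlgebra B]
    (hB : ∀ (F : Finset B) (ε : ℝ), 0 < ε →
      ∃ S : StarSubalgebra ℂ B, FiniteDimensional ℂ S ∧ ∀ x ∈ F, ∃ y ∈ S, ‖x - y‖ < ε)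
    {a : Fin 2 → B} (ha : ∀ i, IsSelfAdjoint (a i)) (x : B) {ε : ℝ} (hε : 0 < ε) :
    ∃ b : Fin 2 → B, (∀ i, IsSelfAdjoint (b i)) ∧ ‖a - b‖ < ε ∧
      ∃ p ∈ NonUnitalStarAlgebra.adjoin ℂ (Set.range b), ‖x - p‖ < ε := by
  classical
  obtain ⟨S, hS, hclose⟩ := hB {a 0, a 1, x} (ε / 2) (half_pos hε)
  obtain ⟨y, hyS, hy⟩ := hclose x (by simp)
  choose c hcS hc using fun i : Fin 2 ↦ hclose (a i) (by fin_cases i <;> simp)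
  let c' : Fin 2 → S := fun i ↦ realPart (⟨c i, hcS i⟩ : S)
  have hc' : ∀ i, IsSelfAdjoint (c' i) := fun i ↦ (realPart (⟨c i, hcS i⟩ : S)).2
  have hac' : ∀ i, ‖a i - c' i‖ < ε / 2 := by
    intro i
    have h₁ : a i - c' i = realPart (a i - c i) := by
      rw [map_sub, AddSubgroup.coe_sub, (ha i).coe_realPart]
      simp [c', realPart_apply_coe]
    rw [h₁]
    exact (realPart.norm_le _).trans_lt (hc i)
  obtain ⟨b, hb, hcb, hgen⟩ := exists_selfAdjoint_pair_adjoin_eq_top hc' (half_pos hε)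
  refine ⟨fun i ↦ b i, fun i ↦ congrArg Subtype.val (hb i), ?_, y, ?_, hy.trans (half_lt_self hε)⟩
  · rw [pi_norm_lt_iff hε]
    intro i
    have h₁ : ‖(c' i : B) - b i‖ < ε / 2 := (norm_le_pi_norm (c' - b) i).trans_lt hcb
    calc ‖a i - b i‖ = ‖(a i - c' i) + (c' i - b i)‖ := by rw [sub_add_sub_cancel]
      _ ≤ ‖a i - c' i‖ + ‖(c' i : B) - b i‖ := norm_add_le _ _
      _ < ε := by linarith [hac' i]
  · have hle : NonUnitalAlgebra.adjoin ℂ (Set.range b) ≤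
        (NonUnitalStarAlgebra.adjoin ℂ
          (Set.range fun i ↦ (b i : B))).toNonUnitalSubalgebra.comap S.subtype := by
      refine NonUnitalAlgebra.adjoin_le ?_
      rintro _ ⟨i, rfl⟩
      exact NonUnitalStarAlgebra.subset_adjoin ℂ _ ⟨i, rfl⟩
    have : (⟨y, hyS⟩ : S) ∈ NonUnitalAlgebra.adjoin ℂ (Set.range b) := hgen ▸ trivial
    exact hle this

/-- A Baire category argument: if `B` is separable and every element is approximately contained in
the `*`-subalgebra generated by densely many self-adjoint tuples, then the generating self-adjoint
tuples are dense. -/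
lemma mem_closure_generates {B : Type*} [NonUnitalCStarAlgebra B]
    [TopologicalSpace.SeparableSpace B] {k : ℕ}
    (hB : ∀ a : Fin k → B, (∀ i, IsSelfAdjoint (a i)) → ∀ (x : B) (ε : ℝ), 0 < ε →
      ∃ b : Fin k → B, (∀ i, IsSelfAdjoint (b i)) ∧ ‖a - b‖ < ε ∧
        ∃ p ∈ NonUnitalStarAlgebra.adjoin ℂ (Set.range b), ‖x - p‖ < ε)
    {a : Fin k → B} (ha : ∀ i, IsSelfAdjoint (a i)) :
    a ∈ closure {b : Fin k → B | (∀ i, IsSelfAdjoint (b i)) ∧ Generates b} := by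
  let X := {b : Fin k → B // ∀ i, IsSelfAdjoint (b i)}
  have hclosed : IsClosed {b : Fin k → B | ∀ i, IsSelfAdjoint (b i)} := by
    simp only [Set.ofPred_forall]
    exact isClosed_iInter fun i ↦ isClosed_eq (by fun_prop) (by fun_prop)
  have : CompleteSpace X := hclosed.completeSpace_coe
  let x := TopologicalSpace.denseSeq B
  let U : ℕ × ℕ → Set X := fun n ↦ {b | ∃ p ∈ NonUnitalStarAlgebra.adjoin ℂ (Set.range b.1),
    p ∈ Metric.ball (x n.1) (1 / ((n.2 : ℝ) + 1))}
  have hUo : ∀ n, IsOpen (U n) := fun n ↦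
    (isOpen_setOf_exists_mem_starAdjoin Metric.isOpen_ball).preimage continuous_subtype_val
  have hUd : ∀ n, Dense (U n) := by
    intro n
    rw [Metric.dense_iff]
    intro b ε hε
    obtain ⟨c, hc, hbc, p, hp, hxp⟩ := hB b.1 b.2 (x n.1) (min ε (1 / ((n.2 : ℝ) + 1)))
      (lt_min hε Nat.one_div_pos_of_nat)
    refine ⟨⟨c, hc⟩, ?_, p, hp, ?_⟩
    · rw [Metric.mem_ball', Subtype.dist_eq, dist_eq_norm]
      exact hbc.trans_le (min_le_left _ _)
    · rw [Metric.mem_ball', dist_eq_norm]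
      exact hxp.trans_le (min_le_right _ _)
  rw [Metric.mem_closure_iff]
  intro ε hε
  obtain ⟨b, hab, hb⟩ := Metric.dense_iff.1 (dense_iInter_of_isOpen hUo hUd) ⟨a, ha⟩ ε hε
  refine ⟨b.1, ⟨b.2, ?_⟩, Metric.mem_ball'.1 hab⟩
  rw [Generates, eq_top_iff]
  intro y _
  refine closure_minimal (s := Set.range x) ?_
    (NonUnitalStarSubalgebra.isClosed_topologicalClosure _)
    (TopologicalSpace.denseRange_denseSeq B y)
  rintro _ ⟨n, rfl⟩
  refine Metric.mem_closure_iff.2 fun δ hδ ↦ ?_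
  obtain ⟨m, hm⟩ := exists_nat_one_div_lt hδ
  obtain ⟨p, hp, hpx⟩ := Set.mem_iInter.1 hb (n, m)
  exact ⟨p, hp, (Metric.mem_ball'.1 hpx).trans hm⟩

/-- Local approximation by finite-dimensional `*`-subalgebras passes to the unitization. -/
lemma exists_finiteDimensional_starSubalgebra_unitization {A : Type*} [NonUnitalCStarAlgebra A]
    (hAF : ∀ (F : Finset A) (ε : ℝ), 0 < ε →
      ∃ S : NonUnitalStarSubalgebra ℂ A, IsClosed (S : Set A) ∧ FiniteDimensional ℂ S ∧
        ∀ x ∈ F, ∃ y ∈ S, ‖x - y‖ < ε)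
    (F : Finset (Unitization ℂ A)) {ε : ℝ} (hε : 0 < ε) :
    ∃ S : StarSubalgebra ℂ (Unitization ℂ A), FiniteDimensional ℂ S ∧
      ∀ x ∈ F, ∃ y ∈ S, ‖x - y‖ < ε := by
  classical
  obtain ⟨S, -, hS, hclose⟩ := hAF (F.image fun x ↦ x.snd) ε hε
  have hfin : FiniteDimensional ℂ (Unitization ℂ S) :=
    (Unitization.linearEquiv ℂ ℂ S).symm.finiteDimensional
  let φ : Unitization ℂ S →⋆ₐ[ℂ] Unitization ℂ A :=
    Unitization.starMap (NonUnitalStarSubalgebraClass.subtype S)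
  refine ⟨φ.range, ?_, fun x hx ↦ ?_⟩
  · exact inferInstanceAs (FiniteDimensional ℂ (φ : Unitization ℂ S →ₗ[ℂ] Unitization ℂ A).range)
  · obtain ⟨y, hy, hxy⟩ := hclose x.snd (Finset.mem_image_of_mem (fun x ↦ x.snd) hx)
    refine ⟨_, ⟨Unitization.inl x.fst + Unitization.inr ⟨y, hy⟩, rfl⟩, ?_⟩
    have : x - φ (Unitization.inl x.fst + Unitization.inr ⟨y, hy⟩) =
        Unitization.inr (x.snd - y) := by
      have hφ : φ (Unitization.inl x.fst + Unitization.inr ⟨y, hy⟩) =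
          Unitization.inl x.fst + Unitization.inr y := by
        simp [φ, Unitization.algebraMap_eq_inl]
      rw [hφ, Unitization.inr_sub]
      nth_rw 1 [← Unitization.inl_fst_add_inr_snd_eq x]
      exact add_sub_add_left_eq_sub _ _ _
    change ‖x - φ _‖ < ε
    rwa [this, Unitization.norm_inr]

/-- Every separable AF-algebra `A` (approximated by finite-dimensional closed
`*`-subalgebras) satisfies `gr(A) ≤ 1`: the set `Gen_2(Ã)_sa` is dense in `Ã²_sa`, where `Ã`
is the minimal unitization. -/
theorem gr_AF_le_one {A : Type*} [NonUnitalCStarAlgebra A]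
    [TopologicalSpace.SeparableSpace A]
    (hAF : ∀ (F : Finset A) (ε : ℝ), 0 < ε →
      ∃ S : NonUnitalStarSubalgebra ℂ A, IsClosed (S : Set A) ∧ FiniteDimensional ℂ S ∧
        ∀ x ∈ F, ∃ y ∈ S, ‖x - y‖ < ε) :
    ∀ a : Fin 2 → Unitization ℂ A, (∀ i, IsSelfAdjoint (a i)) →
      a ∈ closure {b : Fin 2 → Unitization ℂ A | (∀ i, IsSelfAdjoint (b i)) ∧ Generates b} := by
  have : TopologicalSpace.SeparableSpace (Unitization ℂ A) :=
    (Unitization.uniformEquivProd (𝕜 := ℂ) (A := A)).symm.surjective.denseRange.separableSpace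
      Unitization.uniformEquivProd.symm.continuous
  exact fun a ha ↦ mem_closure_generates (fun a ha x ε hε ↦ exists_selfAdjoint_pair_near
    (fun F ε hε ↦ exists_finiteDimensional_starSubalgebra_unitization hAF F hε) ha x hε) ha
end
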